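/- Let G be a group, F a field of characteristic 0, and let A = ⊕_{g∈G} A^{(g)} be a finite-dimensional associative G-graded algebra over F. Then the limit lim_{n→∞} (c_n^gr(A))^{1/n} exists and is a nonnegative integer (the graded PI-exponent of A); this is the analog of Amitsur's conjecture for graded codimensions. -/

import Mathlib

/-- The ideal of graded polynomial identities of a `G`-graded algebra `A` with grading `𝒜`,
inside the free `G`-graded associative algebra `F⟨X^gr⟩ = FreeAlgebra F (ℕ × G)` on the
variables `x_i^{(g)} = ι (i, g)`. -/
def gradedIdentities (F : Type*) [Field F] {G : Type*} {A : Type*} [Ring A] [Algebra F A]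
    (𝒜 : G → Submodule F A) : Submodule F (FreeAlgebra F (ℕ × G)) where
  carrier := {f | ∀ φ : FreeAlgebra F (ℕ × G) →ₐ[F] A,
    (∀ (i : ℕ) (g : G), φ (FreeAlgebra.ι F (i, g)) ∈ 𝒜 g) → φ f = 0}
  add_mem' := by
    intro x y hx hy φ hφ
    rw [map_add, hx φ hφ, hy φ hφ, add_zero]
  zero_mem' := by
    intro φ _
    exact map_zero φ
  smul_mem' := by
    intro c x hx φ hφ
    rw [map_smul, hx φ hφ, smul_zero]

/-- The space `P_n^gr` of multilinear graded polynomials in `x_1, …, x_n`. -/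
def multilinearGradedPolys (F : Type*) [Field F] (G : Type*) (n : ℕ) :
    Submodule F (FreeAlgebra F (ℕ × G)) :=
  Submodule.span F {x | ∃ (σ : Equiv.Perm (Fin n)) (g : Fin n → G),
    x = (List.ofFn fun k => FreeAlgebra.ι F (((σ k : Fin n) : ℕ), g k)).prod}

/-- The `n`-th graded codimension `c_n^gr(A) = dim_F (P_n^gr / (P_n^gr ∩ Id^gr(A)))`. -/
noncomputable def gradedCodim (F : Type*) [Field F] {G : Type*} {A : Type*} [Ring A]
    [Algebra F A] (𝒜 : G → Submodule F A) (n : ℕ) : ℕ :=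
  Module.finrank F (↥(multilinearGradedPolys F G n) ⧸
    (Submodule.comap (multilinearGradedPolys F G n).subtype (gradedIdentities F 𝒜)))


open Finset in
theorem sq_sum_norm_sq_le_finrank_mul {ι E : Type*} [Fintype ι] [NormedAddCommGroup E]
    [InnerProductSpace ℝ E] [FiniteDimensional ℝ E] (v : ι → E) :
    (∑ i, ‖v i‖ ^ 2) ^ 2 ≤
      Module.finrank ℝ (Submodule.span ℝ (Set.range v)) * ∑ i, ∑ j, (inner ℝ (v i) (v j)) ^ 2 := by
  set S := Submodule.span ℝ (Set.range v)
  let w : ι → S := fun i => ⟨v i, Submodule.subset_span ⟨i, rfl⟩⟩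
  let b := stdOrthonormalBasis ℝ S
  have key : ∀ i j, ∑ k, inner ℝ (w i) (b k) * inner ℝ (b k) (w j) = inner ℝ (v i) (v j) :=
    fun i j => b.sum_inner_mul_inner (w i) (w j)
  have h1 : ∑ i, ‖v i‖ ^ 2 = ∑ k, ∑ i, inner ℝ (w i) (b k) * inner ℝ (b k) (w i) := by
    rw [Finset.sum_comm]
    exact Finset.sum_congr rfl fun i _ => by rw [key, real_inner_self_eq_norm_sq]
  have h2 : ∑ i, ∑ j, (inner ℝ (v i) (v j)) ^ 2 =
      ∑ k, ∑ l, (∑ i, inner ℝ (w i) (b k) * inner ℝ (b l) (w i)) ^ 2 := by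
    have : ∀ i j, (inner ℝ (v i) (v j)) ^ 2 = ∑ k, ∑ l,
        (inner ℝ (w i) (b k) * inner ℝ (b l) (w i)) *
          (inner ℝ (w j) (b k) * inner ℝ (b l) (w j)) := by
      intro i j
      rw [← key, sq, Finset.sum_mul_sum]
      refine Finset.sum_congr rfl fun k _ => Finset.sum_congr rfl fun l _ => ?_
      rw [real_inner_comm (b k) (w j), real_inner_comm (b l) (w i)]
      ring
    simp_rw [this]
    simp_rw [sq, Finset.sum_mul_sum]
    calc _ = ∑ i, ∑ k, ∑ j, ∑ l, (inner ℝ (w i) (b k) * inner ℝ (b l) (w i)) *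
          (inner ℝ (w j) (b k) * inner ℝ (b l) (w j)) :=
          Finset.sum_congr rfl fun i _ => Finset.sum_comm
      _ = ∑ k, ∑ i, ∑ j, ∑ l, (inner ℝ (w i) (b k) * inner ℝ (b l) (w i)) *
          (inner ℝ (w j) (b k) * inner ℝ (b l) (w j)) := Finset.sum_comm
      _ = ∑ k, ∑ i, ∑ l, ∑ j, (inner ℝ (w i) (b k) * inner ℝ (b l) (w i)) *
          (inner ℝ (w j) (b k) * inner ℝ (b l) (w j)) :=
          Finset.sum_congr rfl fun k _ => Finset.sum_congr rfl fun i _ => Finset.sum_comm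
      _ = _ := Finset.sum_congr rfl fun k _ => Finset.sum_comm
  rw [h1, h2]
  calc _ ≤ (Finset.univ : Finset (Fin (Module.finrank ℝ S))).card *
        ∑ k, (∑ i, inner ℝ (w i) (b k) * inner ℝ (b k) (w i)) ^ 2 := sq_sum_le_card_mul_sum_sq
    _ ≤ _ := by
      rw [Finset.card_univ, Fintype.card_fin]
      refine mul_le_mul_of_nonneg_left (Finset.sum_le_sum fun k _ => ?_) (Nat.cast_nonneg _)
      exact Finset.single_le_sum
        (f := fun l => (∑ i, inner ℝ (w i) (b k) * inner ℝ (b l) (w i)) ^ 2)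
        (fun l _ => sq_nonneg _) (Finset.mem_univ k)

open scoped Matrix in
theorem LinearIndependent.map_algebraMap {F K T Y : Type*} [Field F] [Field K] [Algebra F K]
    [Fintype Y] {w : T → Y → F} (hw : LinearIndependent F w) :
    LinearIndependent K (fun t y => algebraMap F K (w t y)) := by
  classical
  rw [linearIndependent_iff_finset_linearIndependent]
  intro s
  have hs : LinearIndependent F (fun t : s => w t) := hw.comp _ Subtype.val_injective
  let f : (s → F) →ₗ[F] (Y → F) := Fintype.linearCombination F (fun t : s => w t)
  have hf : LinearMap.ker f = ⊥ := by
    rw [LinearMap.ker_eq_bot]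
    exact linearIndependent_iff_injective_fintypeLinearCombination.mp hs
  obtain ⟨g, hg⟩ := f.exists_leftInverse_of_injective hf
  have hM : LinearMap.toMatrix' g * LinearMap.toMatrix' f = 1 := by
    rw [← LinearMap.toMatrix'_comp, hg, LinearMap.toMatrix'_id]
  have hM' : (LinearMap.toMatrix' g).map (algebraMap F K) *
      (LinearMap.toMatrix' f).map (algebraMap F K) = 1 := by
    rw [← Matrix.map_mul, hM, Matrix.map_one _ (map_zero _) (map_one _)]
  rw [Fintype.linearIndependent_iff]
  intro c hc
  have : (LinearMap.toMatrix' f).map (algebraMap F K) *ᵥ c = 0 := by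
    rw [← hc]
    have hfe : ∀ y i, LinearMap.toMatrix' f y i = w i y := fun y i => by
      rw [LinearMap.toMatrix'_apply, Fintype.linearCombination_apply_single, one_smul]
    ext y
    simp [Matrix.mulVec, dotProduct, hfe, mul_comm]
  have h0 : c = 0 := by
    rw [← Matrix.one_mulVec c, ← hM', ← Matrix.mulVec_mulVec, this, Matrix.mulVec_zero]
  simp [h0]

theorem finrank_span_map_algebraMap (F K : Type*) {T Y : Type*} [Field F] [Field K] [Algebra F K]
    [Fintype Y] (w : T → Y → F) :
    Module.finrank K (Submodule.span K (Set.range fun t y => algebraMap F K (w t y))) =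
      Module.finrank F (Submodule.span F (Set.range w)) := by
  obtain ⟨b, hb, hspan, hli⟩ := exists_linearIndependent F (Set.range w)
  have hbfin : Finite b := hli.finite
  have hfin : Fintype b := Fintype.ofFinite b
  have hsub : Submodule.span K (Set.range fun t y => algebraMap F K (w t y)) =
      Submodule.span K (Set.range fun (x : b) y => algebraMap F K ((x : Y → F) y)) := by
    apply le_antisymm
    · rw [Submodule.span_le]
      rintro _ ⟨t, rfl⟩
      have ht : w t ∈ Submodule.span F b := by
        rw [hspan]; exact Submodule.subset_span ⟨t, rfl⟩
      have : ∀ z ∈ Submodule.span F b, (fun y => algebraMap F K (z y)) ∈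
          Submodule.span K (Set.range fun (x : b) y => algebraMap F K ((x : Y → F) y)) := by
        intro z hz
        induction hz using Submodule.span_induction with
        | mem x hx => exact Submodule.subset_span ⟨⟨x, hx⟩, rfl⟩
        | zero => convert Submodule.zero_mem _ using 1; ext y; simp
        | add x y _ _ hx hy => convert Submodule.add_mem _ hx hy using 1; ext y; simp
        | smul a x _ hx =>
          convert Submodule.smul_mem _ (algebraMap F K a) hx using 1; ext y; simp
      exact this _ ht
    · rw [Submodule.span_le]
      rintro _ ⟨⟨x, hx⟩, rfl⟩
      obtain ⟨t, rfl⟩ := hb hx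
      exact Submodule.subset_span ⟨t, rfl⟩
  rw [hsub, finrank_span_eq_card hli.map_algebraMap, ← hspan]
  have := finrank_span_eq_card hli
  rw [Subtype.range_coe] at this
  rw [this]

theorem card_orbits_perm_le (m : ℕ) (Y : Type*) [Fintype Y] :
    ∑ γ : Equiv.Perm (Fin m), Nat.card {ξ : Fin m → Y // ∀ i, ξ (γ i) = ξ i} ≤
      (m + 1) ^ Fintype.card Y * m.factorial := by
  classical
  let _ : MulAction (Equiv.Perm (Fin m)) (Fin m → Y) := arrowAction
  have hact : ∀ (γ : Equiv.Perm (Fin m)) (ξ : Fin m → Y), γ • ξ = fun i => ξ (γ⁻¹ i) :=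
    fun γ ξ => rfl
  let _ : ∀ γ : Equiv.Perm (Fin m), Fintype (MulAction.fixedBy (Fin m → Y) γ) :=
    fun γ => Fintype.ofFinite _
  let _ : Fintype (Quotient (MulAction.orbitRel (Equiv.Perm (Fin m)) (Fin m → Y))) :=
    Fintype.ofFinite _
  have hB := MulAction.sum_card_fixedBy_eq_card_orbits_mul_card_group
    (Equiv.Perm (Fin m)) (Fin m → Y)
  have h1 : ∀ γ : Equiv.Perm (Fin m), Nat.card {ξ : Fin m → Y // ∀ i, ξ (γ i) = ξ i} =
      Fintype.card (MulAction.fixedBy (Fin m → Y) γ) := by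
    intro γ
    rw [← Nat.card_eq_fintype_card]
    refine Nat.card_congr (Equiv.subtypeEquivRight fun ξ => ?_)
    rw [MulAction.mem_fixedBy, hact, funext_iff]
    constructor
    · intro h i
      have := h (γ⁻¹ i)
      simpa using this.symm
    · intro h i
      have := h (γ i)
      simpa using this.symm
  simp_rw [h1]
  rw [hB, Fintype.card_perm, Fintype.card_fin]
  refine Nat.mul_le_mul_right _ ?_
  let cnt : (Fin m → Y) → (Y → Fin (m + 1)) := fun ξ y =>
    ⟨Fintype.card {i // ξ i = y}, Nat.lt_succ_of_le (by
      simpa using Fintype.card_subtype_le (fun i => ξ i = y))⟩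
  have hinj : ∀ ξ η : Fin m → Y, cnt ξ = cnt η →
      MulAction.orbitRel (Equiv.Perm (Fin m)) (Fin m → Y) ξ η := by
    intro ξ η h
    have hc : ∀ y, Fintype.card {i // ξ i = y} = Fintype.card {i // η i = y} := fun y => by
      have := congrFun h y
      simpa [cnt] using this
    let e : Fin m ≃ Fin m := Equiv.ofFiberEquiv fun y => Fintype.equivOfCardEq (hc y)
    have he : ∀ i, η (e i) = ξ i := fun i => Equiv.ofFiberEquiv_map _ i
    refine ⟨e⁻¹, ?_⟩
    change e⁻¹ • η = ξ
    rw [hact]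
    funext i
    simpa using he i
  calc _ ≤ Fintype.card (Y → Fin (m + 1)) := by
        refine Fintype.card_le_of_injective (fun q => cnt (Quotient.out q)) fun p q hpq => ?_
        rw [← Quotient.out_eq p, ← Quotient.out_eq q]
        exact Quotient.sound (hinj _ _ hpq)
    _ = _ := by simp

/-- The span of the permutation matrices of `S_m` acting on words of length `m` in `d` letters
has dimension at least `d ^ (2 m) / (m + 1) ^ (d ^ 2)`. -/
theorem pow_le_finrank_span_perm (K : Type*) [Field K] [CharZero K] (d m : ℕ) :
    d ^ (2 * m) ≤ Module.finrank K (Submodule.span K (Set.range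
      fun (σ : Equiv.Perm (Fin m)) (p : (Fin m → Fin d) × (Fin m → Fin d)) =>
        if ∀ j, p.1 j = p.2 (σ j) then (1 : K) else 0)) * (m + 1) ^ (d ^ 2) := by
  classical
  let w : Equiv.Perm (Fin m) → (Fin m → Fin d) × (Fin m → Fin d) → ℚ :=
    fun σ p => if ∀ j, p.1 j = p.2 (σ j) then 1 else 0
  have hK := finrank_span_map_algebraMap ℚ K w
  have hR := finrank_span_map_algebraMap ℚ ℝ w
  have hwK : (fun σ p => algebraMap ℚ K (w σ p)) =
      fun (σ : Equiv.Perm (Fin m)) (p : (Fin m → Fin d) × (Fin m → Fin d)) =>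
        if ∀ j, p.1 j = p.2 (σ j) then (1 : K) else 0 := by
    funext σ p; simp only [w]; split_ifs <;> simp
  rw [hwK] at hK
  rw [hK, ← hR]
  set r := Module.finrank ℝ
    (Submodule.span ℝ (Set.range fun σ p => algebraMap ℚ ℝ (w σ p))) with hr
  let L := (WithLp.linearEquiv 2 ℝ ((Fin m → Fin d) × (Fin m → Fin d) → ℝ)).symm
  let v : Equiv.Perm (Fin m) → EuclideanSpace ℝ ((Fin m → Fin d) × (Fin m → Fin d)) :=
    fun σ => L (fun p => algebraMap ℚ ℝ (w σ p))
  have hrv : Module.finrank ℝ (Submodule.span ℝ (Set.range v)) = r := by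
    have : Set.range v = L '' (Set.range fun σ p => algebraMap ℚ ℝ (w σ p)) := by
      rw [← Set.range_comp]; rfl
    rw [this]
    have h2 := Submodule.map_span L.toLinearMap (Set.range fun σ p => algebraMap ℚ ℝ (w σ p))
    rw [hr]
    exact (congrArg (fun S : Submodule ℝ _ => Module.finrank ℝ S) h2.symm).trans
      (LinearEquiv.finrank_map_eq L _)
  have hG := sq_sum_norm_sq_le_finrank_mul v
  rw [hrv] at hG
  have hinner : ∀ σ τ, inner ℝ (v σ) (v τ) =
      (Nat.card {ξ : Fin m → Fin d // ∀ i, ξ ((σ * τ⁻¹) i) = ξ i} : ℝ) := by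
    intro σ τ
    have h3 : inner ℝ (v σ) (v τ) = ∑ p : (Fin m → Fin d) × (Fin m → Fin d),
        if (∀ j, p.1 j = p.2 (σ j)) ∧ (∀ j, p.1 j = p.2 (τ j)) then (1 : ℝ) else 0 := by
      rw [PiLp.inner_apply]
      refine Finset.sum_congr rfl fun p _ => ?_
      simp only [v, L, w, WithLp.linearEquiv_symm_apply]
      by_cases h1 : ∀ j, p.1 j = p.2 (σ j) <;> by_cases h2 : ∀ j, p.1 j = p.2 (τ j) <;>
        simp [h1, h2]
    rw [h3, Finset.sum_boole, Nat.card_eq_fintype_card, ← Fintype.card_subtype]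
    congr 1
    refine Fintype.card_congr
      { toFun := fun p => ⟨p.1.2, fun i => ?_⟩
        invFun := fun ξ => ⟨(fun j => ξ.1 (σ j), ξ.1), fun j => rfl, fun j => ?_⟩
        left_inv := ?_
        right_inv := ?_ }
    · have h1 := p.2.1 (τ⁻¹ i)
      have h2 := p.2.2 (τ⁻¹ i)
      rw [h1] at h2
      simpa using h2
    · have := ξ.2 (τ j)
      simpa using this
    · rintro ⟨⟨a, b⟩, h1, h2⟩
      simp only [Subtype.mk.injEq, Prod.mk.injEq, and_true]
      funext j; exact (h1 j).symm
    · rintro ⟨ξ, h⟩; rfl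
  have hnorm : ∀ σ, ‖v σ‖ ^ 2 = (d : ℝ) ^ m := by
    intro σ
    rw [← real_inner_self_eq_norm_sq, hinner]
    simp
  have hsum : ∑ σ, ∑ τ, (inner ℝ (v σ) (v τ)) ^ 2 ≤
      (m.factorial : ℝ) * ((m + 1) ^ (d ^ 2) * m.factorial) := by
    have h4 : ∀ γ : Equiv.Perm (Fin m),
        (Nat.card {ξ : Fin m → Fin d // ∀ i, ξ (γ i) = ξ i} : ℝ) ^ 2 =
        (Nat.card {ξ : Fin m → Fin d × Fin d // ∀ i, ξ (γ i) = ξ i} : ℝ) := by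
      intro γ
      rw [← Nat.cast_pow, sq, ← Nat.card_prod]
      congr 1
      refine Nat.card_congr
        { toFun := fun p => ⟨fun i => (p.1.1 i, p.2.1 i), fun i => Prod.ext (p.1.2 i) (p.2.2 i)⟩
          invFun := fun ξ => ⟨⟨fun i => (ξ.1 i).1, fun i => congrArg Prod.fst (ξ.2 i)⟩,
            ⟨fun i => (ξ.1 i).2, fun i => congrArg Prod.snd (ξ.2 i)⟩⟩
          left_inv := fun p => rfl
          right_inv := fun ξ => rfl }
    have h5 : ∀ τ : Equiv.Perm (Fin m), ∑ σ, (inner ℝ (v σ) (v τ)) ^ 2 =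
        ∑ γ : Equiv.Perm (Fin m),
          (Nat.card {ξ : Fin m → Fin d × Fin d // ∀ i, ξ (γ i) = ξ i} : ℝ) := by
      intro τ
      simp_rw [hinner, h4]
      exact Fintype.sum_equiv (Equiv.mulRight τ⁻¹) _ _ fun σ => rfl
    rw [Finset.sum_comm]
    simp_rw [h5]
    rw [Finset.sum_const, Finset.card_univ, Fintype.card_perm, Fintype.card_fin, nsmul_eq_mul]
    refine mul_le_mul_of_nonneg_left ?_ (Nat.cast_nonneg _)
    have := card_orbits_perm_le m (Fin d × Fin d)
    rw [Fintype.card_prod, Fintype.card_fin, ← sq] at this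
    exact_mod_cast this
  simp_rw [hnorm] at hG
  rw [Finset.sum_const, Finset.card_univ, Fintype.card_perm, Fintype.card_fin,
    nsmul_eq_mul] at hG
  have hf : (0 : ℝ) < m.factorial := by exact_mod_cast m.factorial_pos
  have h6 : (m.factorial : ℝ) ^ 2 * (d : ℝ) ^ (2 * m) ≤
      (m.factorial : ℝ) ^ 2 * (r * (m + 1) ^ (d ^ 2)) := by
    calc (m.factorial : ℝ) ^ 2 * (d : ℝ) ^ (2 * m) = (m.factorial * (d : ℝ) ^ m) ^ 2 := by ring
      _ ≤ _ := hG
      _ ≤ r * (m.factorial * ((m + 1) ^ (d ^ 2) * m.factorial)) :=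
        mul_le_mul_of_nonneg_left hsum (Nat.cast_nonneg _)
      _ = _ := by ring
  have h7 := le_of_mul_le_mul_left h6 (by positivity)
  exact_mod_cast h7

namespace GradedCodim

set_option linter.unusedSectionVars false

section Projections

variable {K A G I : Type*} [Field K] [Ring A] [Algebra K A] [Group G] [DecidableEq G]
  [Fintype I] (b : Module.Basis I K A) (deg : I → G)

/-- The basis `b` is homogeneous, `b i` having degree `deg i`, for a group grading of `A`. -/
def IsGradedBasis : Prop :=
  ∀ i j k, b.repr (b i * b j) k ≠ 0 → deg k = deg i * deg j

/-- The projection onto the homogeneous component of degree `g`. -/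
noncomputable def gproj (g : G) : A →ₗ[K] A :=
  b.constr K fun i => if deg i = g then b i else 0

theorem gproj_basis (g : G) (i : I) : gproj b deg g (b i) = if deg i = g then b i else 0 :=
  b.constr_basis K _ i

theorem gproj_gproj (g h : G) (x : A) :
    gproj b deg g (gproj b deg h x) = if g = h then gproj b deg h x else 0 := by
  have : gproj b deg g ∘ₗ gproj b deg h = if g = h then gproj b deg h else 0 := by
    refine b.ext fun i => ?_
    simp only [LinearMap.comp_apply, gproj_basis]
    by_cases h1 : deg i = h <;> by_cases h2 : g = h
    · subst h1; subst h2; simp [gproj_basis]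
    · subst h1; simp [gproj_basis, h2, Ne.symm h2]
    · simp [gproj_basis, h1, h2]
    · simp [h1, h2]
  have h2 := LinearMap.congr_fun this x
  rw [LinearMap.comp_apply] at h2
  rw [h2]
  split_ifs <;> simp

theorem sum_gproj (x : A) : ∑ g ∈ Finset.univ.image deg, gproj b deg g x = x := by
  have : ∑ g ∈ Finset.univ.image deg, gproj b deg g = LinearMap.id := by
    refine b.ext fun i => ?_
    simp [LinearMap.sum_apply, gproj_basis]
  have h2 := LinearMap.congr_fun this x
  simpa [LinearMap.sum_apply] using h2

variable {b deg}

theorem IsGradedBasis.gproj_basis_mul (hb : IsGradedBasis b deg) (g : G) (i j : I) :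
    gproj b deg g (b i * b j) = if deg i * deg j = g then b i * b j else 0 := by
  have h1 : gproj b deg g (b i * b j) = ∑ k, b.repr (b i * b j) k • gproj b deg g (b k) := by
    conv_lhs => rw [← b.sum_repr (b i * b j), map_sum]
    simp_rw [map_smul]
  rw [h1]
  have h2 : ∀ k, b.repr (b i * b j) k • gproj b deg g (b k) =
      if deg i * deg j = g then b.repr (b i * b j) k • b k else 0 := by
    intro k
    by_cases h : b.repr (b i * b j) k = 0
    · simp [h]
    · rw [gproj_basis, hb i j k h]
      split_ifs <;> simp
  simp_rw [h2]
  split_ifs with h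
  · exact b.sum_repr _
  · simp

theorem IsGradedBasis.gproj_mul_basis (hb : IsGradedBasis b deg) (g : G) (x : A) (j : I) :
    gproj b deg g (x * b j) = gproj b deg (g * (deg j)⁻¹) x * b j := by
  have : gproj b deg g ∘ₗ LinearMap.mulRight K (b j) =
      LinearMap.mulRight K (b j) ∘ₗ gproj b deg (g * (deg j)⁻¹) := by
    refine b.ext fun i => ?_
    simp only [LinearMap.comp_apply, LinearMap.mulRight_apply, hb.gproj_basis_mul, gproj_basis,
      eq_mul_inv_iff_mul_eq]
    split_ifs <;> simp
  exact LinearMap.congr_fun this x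

theorem IsGradedBasis.gproj_basis_mul' (hb : IsGradedBasis b deg) (g : G) (x : A) (i : I) :
    gproj b deg g (b i * x) = b i * gproj b deg ((deg i)⁻¹ * g) x := by
  have : gproj b deg g ∘ₗ LinearMap.mulLeft K (b i) =
      LinearMap.mulLeft K (b i) ∘ₗ gproj b deg ((deg i)⁻¹ * g) := by
    refine b.ext fun j => ?_
    simp only [LinearMap.comp_apply, LinearMap.mulLeft_apply, hb.gproj_basis_mul, gproj_basis,
      eq_inv_mul_iff_mul_eq]
    split_ifs <;> simp
  exact LinearMap.congr_fun this x

theorem IsGradedBasis.gproj_mul_gproj (hb : IsGradedBasis b deg) (g h : G) (x y : A) :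
    gproj b deg g (x * gproj b deg h y) = gproj b deg (g * h⁻¹) x * gproj b deg h y := by
  have : gproj b deg g ∘ₗ LinearMap.mulLeft K x ∘ₗ gproj b deg h =
      LinearMap.mulLeft K (gproj b deg (g * h⁻¹) x) ∘ₗ gproj b deg h := by
    refine b.ext fun j => ?_
    simp only [LinearMap.comp_apply, LinearMap.mulLeft_apply, gproj_basis]
    split_ifs with h1
    · rw [hb.gproj_mul_basis, h1]
    · simp
  exact LinearMap.congr_fun this y

theorem IsGradedBasis.gproj_gproj_mul (hb : IsGradedBasis b deg) (g h : G) (x y : A) :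
    gproj b deg g (gproj b deg h x * y) = gproj b deg h x * gproj b deg (h⁻¹ * g) y := by
  have : gproj b deg g ∘ₗ LinearMap.mulRight K y ∘ₗ gproj b deg h =
      LinearMap.mulRight K (gproj b deg (h⁻¹ * g) y) ∘ₗ gproj b deg h := by
    refine b.ext fun j => ?_
    simp only [LinearMap.comp_apply, LinearMap.mulRight_apply, gproj_basis]
    split_ifs with h1
    · rw [hb.gproj_basis_mul', h1]
    · simp
  exact LinearMap.congr_fun this x

theorem IsGradedBasis.gproj_one (hb : IsGradedBasis b deg) (g : G) :
    gproj b deg g (1 : A) = if g = 1 then 1 else 0 := by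
  have h1 : ∀ x : A, gproj b deg 1 1 * x = x := by
    intro x
    have : LinearMap.mulLeft K (gproj b deg 1 (1 : A)) = LinearMap.id := by
      refine b.ext fun i => ?_
      have := hb.gproj_mul_basis (deg i) 1 i
      rw [one_mul, gproj_basis, if_pos rfl, mul_inv_cancel] at this
      simpa using this.symm
    exact LinearMap.congr_fun this x
  have h2 : gproj b deg 1 (1 : A) = 1 := by simpa using h1 1
  rw [← h2, gproj_gproj]

end Projections

section Words

variable {K A G I : Type*} [Field K] [Ring A] [Algebra K A] [Group G] [DecidableEq G]
  [Fintype I] (b : Module.Basis I K A) (deg : I → G)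

/-- `IsWord b deg s k f` says that `f` is a function of `x : ℕ → A` given by a product of
homogeneous components of the `x i`, `i ∈ s`, each occurring once, and of `k` elements of the
basis `b`. -/
inductive IsWord : Finset ℕ → ℕ → ((ℕ → A) → A) → Prop
  | nil : IsWord ∅ 0 fun _ => 1
  | var (i : ℕ) (g : G) (s : Finset ℕ) (k : ℕ) (f : (ℕ → A) → A) (hi : i ∉ s)
      (hf : IsWord s k f) : IsWord (insert i s) k fun x => gproj b deg g (x i) * f x
  | const (j : I) (s : Finset ℕ) (k : ℕ) (f : (ℕ → A) → A)
      (hf : IsWord s k f) : IsWord s (k + 1) fun x => b j * f x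

/-- The space of multilinear functions of the `x i`, `i ∈ s`, spanned by words with `k`
constants. -/
def multi (s : Finset ℕ) (k : ℕ) : Submodule K ((ℕ → A) → A) :=
  Submodule.span K {f | IsWord b deg s k f}

variable {b deg} {s t : Finset ℕ} {k l : ℕ} {f f' : (ℕ → A) → A}

theorem IsWord.congr (hf : IsWord b deg s k f) {x y : ℕ → A} (h : ∀ i ∈ s, x i = y i) :
    f x = f y := by
  induction hf with
  | nil => rfl
  | var i g s k f hi hf ih =>
    beta_reduce
    rw [h i (Finset.mem_insert_self i s), ih fun j hj => h j (Finset.mem_insert_of_mem hj)]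
  | const j s k f hf ih => exact congrArg _ (ih h)

theorem multi_congr (hf : f ∈ multi b deg s k) {x y : ℕ → A} (h : ∀ i ∈ s, x i = y i) :
    f x = f y := by
  induction hf using Submodule.span_induction with
  | mem f hf => exact IsWord.congr hf h
  | zero => rfl
  | add f f' _ _ h1 h2 => rw [Pi.add_apply, Pi.add_apply, h1, h2]
  | smul c f _ h1 => rw [Pi.smul_apply, Pi.smul_apply, h1]

theorem IsWord.update_linear (hf : IsWord b deg s k f) {i : ℕ} (hi : i ∈ s) (x : ℕ → A) :
    ∃ L : A →ₗ[K] A, ∀ a, f (Function.update x i a) = L a := by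
  induction hf with
  | nil => simp at hi
  | var j g s k f hj hf ih =>
    by_cases hij : i = j
    · subst hij
      refine ⟨LinearMap.mulRight K (f x) ∘ₗ gproj b deg g, fun a => ?_⟩
      have : f (Function.update x i a) = f x := hf.congr fun l hl => by
        rw [Function.update_of_ne]; rintro rfl; exact hj hl
      simp [this]
    · obtain ⟨L, hL⟩ := ih (by simpa [hij] using hi)
      refine ⟨LinearMap.mulLeft K (gproj b deg g (x j)) ∘ₗ L, fun a => ?_⟩
      simp [hL, Function.update_of_ne (Ne.symm hij)]
  | const j s k f hf ih =>
    obtain ⟨L, hL⟩ := ih hi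
    exact ⟨LinearMap.mulLeft K (b j) ∘ₗ L, fun a => by simp [hL]⟩

theorem multi_update_linear (hf : f ∈ multi b deg s k) {i : ℕ} (hi : i ∈ s) (x : ℕ → A) :
    ∃ L : A →ₗ[K] A, ∀ a, f (Function.update x i a) = L a := by
  induction hf using Submodule.span_induction with
  | mem f hf => exact IsWord.update_linear hf hi x
  | zero => exact ⟨0, fun a => rfl⟩
  | add f f' _ _ h1 h2 =>
    obtain ⟨L, hL⟩ := h1
    obtain ⟨L', hL'⟩ := h2
    exact ⟨L + L', fun a => by simp [hL, hL']⟩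
  | smul c f _ h1 =>
    obtain ⟨L, hL⟩ := h1
    exact ⟨c • L, fun a => by simp [hL]⟩

theorem multi_gproj_mul (hf : f ∈ multi b deg s k) {i : ℕ} (hi : i ∉ s) (g : G) :
    (fun x => gproj b deg g (x i) * f x) ∈ multi b deg (insert i s) k := by
  induction hf using Submodule.span_induction with
  | mem f hf => exact Submodule.subset_span (IsWord.var i g s k f hi hf)
  | zero => convert Submodule.zero_mem _ using 1; ext x; simp
  | add f f' _ _ h1 h2 => convert Submodule.add_mem _ h1 h2 using 1; ext x; simp [mul_add]
  | smul c f _ h1 => convert Submodule.smul_mem _ c h1 using 1; ext x; simp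

theorem multi_basis_mul (hf : f ∈ multi b deg s k) (j : I) :
    (fun x => b j * f x) ∈ multi b deg s (k + 1) := by
  induction hf using Submodule.span_induction with
  | mem f hf => exact Submodule.subset_span (IsWord.const j s k f hf)
  | zero => convert Submodule.zero_mem _ using 1; ext x; simp
  | add f f' _ _ h1 h2 => convert Submodule.add_mem _ h1 h2 using 1; ext x; simp [mul_add]
  | smul c f _ h1 => convert Submodule.smul_mem _ c h1 using 1; ext x; simp

theorem multi_mul_left (hf : f ∈ multi b deg s k) (a : A) :
    (fun x => a * f x) ∈ multi b deg s (k + 1) := by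
  have : (fun x => a * f x) = ∑ j, b.repr a j • fun x => b j * f x := by
    ext x
    conv_lhs => rw [← b.sum_repr a, Finset.sum_mul]
    simp
  rw [this]
  exact Submodule.sum_mem _ fun j _ => Submodule.smul_mem _ _ (multi_basis_mul hf j)

theorem multi_one : (fun _ => 1) ∈ multi b deg ∅ 0 := Submodule.subset_span IsWord.nil

theorem multi_const (a : A) : (fun _ => a) ∈ multi b deg ∅ 1 := by
  simpa using multi_mul_left (b := b) (deg := deg) multi_one a

theorem multi_var (i : ℕ) : (fun x => x i) ∈ multi b deg {i} 0 := by
  have : (fun x : ℕ → A => x i) = ∑ g ∈ Finset.univ.image deg,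
      fun x => gproj b deg g (x i) * 1 := by
    ext x
    rw [Finset.sum_apply]
    simp only [mul_one]
    exact (sum_gproj b deg (x i)).symm
  rw [this]
  exact Submodule.sum_mem _ fun g _ => multi_gproj_mul multi_one (Finset.notMem_empty i) g

theorem multi_succ (hf : f ∈ multi b deg s k) : f ∈ multi b deg s (k + 1) := by
  simpa using multi_mul_left hf 1

theorem multi_mono (h : k ≤ l) : multi b deg s k ≤ multi b deg s l := by
  induction h with
  | refl => exact le_rfl
  | step _ ih => exact fun f hf => multi_succ (ih hf)

theorem multi_mul (hf : f ∈ multi b deg s k) (hf' : f' ∈ multi b deg t l) (h : Disjoint s t) :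
    (fun x => f x * f' x) ∈ multi b deg (s ∪ t) (k + l) := by
  induction hf using Submodule.span_induction with
  | mem f hf =>
    induction hf with
    | nil => simpa using hf'
    | var i g s k f hi hf ih =>
      rw [Finset.disjoint_insert_left] at h
      rw [Finset.insert_union]
      simp_rw [mul_assoc]
      exact multi_gproj_mul (ih h.2) (by simp [hi, h.1]) g
    | const j s k f hf ih =>
      rw [add_right_comm]
      simp_rw [mul_assoc]
      exact multi_basis_mul (ih h) j
  | zero => convert Submodule.zero_mem _ using 1; ext x; simp
  | add f f' _ _ h1 h2 => convert Submodule.add_mem _ h1 h2 using 1; ext x; simp [add_mul]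
  | smul c f _ h1 => convert Submodule.smul_mem _ c h1 using 1; ext x; simp

theorem IsWord.homogeneous (hb : IsGradedBasis b deg) (hf : IsWord b deg s k f) :
    ∃ g₀ : G, ∀ g x, gproj b deg g (f x) = if g = g₀ then f x else 0 := by
  induction hf with
  | nil => exact ⟨1, fun g x => hb.gproj_one g⟩
  | var i h s k f hi hf ih =>
    obtain ⟨g₀, hg⟩ := ih
    refine ⟨h * g₀, fun g x => ?_⟩
    rw [hb.gproj_gproj_mul, hg]
    simp only [inv_mul_eq_iff_eq_mul, mul_ite, mul_zero]
  | const j s k f hf ih =>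
    obtain ⟨g₀, hg⟩ := ih
    refine ⟨deg j * g₀, fun g x => ?_⟩
    rw [hb.gproj_basis_mul', hg]
    simp only [inv_mul_eq_iff_eq_mul, mul_ite, mul_zero]

theorem multi_gproj (hb : IsGradedBasis b deg) (hf : f ∈ multi b deg s k) (g : G) :
    (fun x => gproj b deg g (f x)) ∈ multi b deg s k := by
  induction hf using Submodule.span_induction with
  | mem f hf =>
    obtain ⟨g₀, hg⟩ := IsWord.homogeneous hb hf
    simp_rw [hg]
    split_ifs
    · exact Submodule.subset_span hf
    · exact Submodule.zero_mem _
  | zero => convert Submodule.zero_mem _ using 1; ext x; simp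
  | add f f' _ _ h1 h2 => convert Submodule.add_mem _ h1 h2 using 1; ext x; simp
  | smul c f _ h1 => convert Submodule.smul_mem _ c h1 using 1; ext x; simp

theorem multi_subst (hb : IsGradedBasis b deg) (hf : f ∈ multi b deg s k)
    (hf' : f' ∈ multi b deg t l) {i : ℕ} (hi : i ∈ s) (h : Disjoint (s.erase i) t) :
    (fun x => f (Function.update x i (f' x))) ∈ multi b deg (s.erase i ∪ t) (k + l) := by
  induction hf using Submodule.span_induction with
  | mem f hf =>
    induction hf with
    | nil => simp at hi
    | var j g s k f hj hf ih =>
      by_cases hij : i = j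
      · subst hij
        rw [Finset.erase_insert hj] at h ⊢
        have : ∀ x a, f (Function.update x i a) = f x := fun x a => hf.congr fun l hl => by
          rw [Function.update_of_ne]; rintro rfl; exact hj hl
        simp only [this, Function.update_self]
        rw [Finset.union_comm, add_comm]
        exact multi_mul (multi_gproj hb hf' g) (Submodule.subset_span hf) h.symm
      · have hi' : i ∈ s := by simpa [hij] using hi
        rw [Finset.erase_insert_of_ne (Ne.symm hij)] at h ⊢
        rw [Finset.disjoint_insert_left] at h
        rw [Finset.insert_union]
        simp only [Function.update_of_ne (Ne.symm hij)]
        exact multi_gproj_mul (ih hi' h.2) (by simp [hj, h.1]) g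
    | const j s k f hf ih =>
      rw [add_right_comm]
      exact multi_basis_mul (ih hi h) j
  | zero => exact Submodule.zero_mem _
  | add f f' _ _ h1 h2 => exact Submodule.add_mem _ h1 h2
  | smul c f _ h1 => exact Submodule.smul_mem _ c h1

theorem multi_specialize (hb : IsGradedBasis b deg) (hf : f ∈ multi b deg s k) {i : ℕ}
    (hi : i ∈ s) (a : A) :
    (fun x => f (Function.update x i a)) ∈ multi b deg (s.erase i) (k + 1) := by
  simpa using multi_subst hb hf (multi_const a) hi (Finset.disjoint_empty_right _)

theorem multi_eq_zero {Z : Type*} {z : Z → A} (hz : Submodule.span K (Set.range z) = ⊤)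
    (hf : f ∈ multi b deg s k) (h : ∀ x : ℕ → A, (∀ i ∈ s, x i ∈ Set.range z) → f x = 0) :
    f = 0 := by
  have key : ∀ t ⊆ s, ∀ x : ℕ → A, (∀ i ∈ s, i ∉ t → x i ∈ Set.range z) → f x = 0 := by
    intro t
    induction t using Finset.induction with
    | empty => exact fun _ x hx => h x fun i hi => hx i hi (Finset.notMem_empty i)
    | insert j t hj ih =>
      intro hts x hx
      have hjs : j ∈ s := hts (Finset.mem_insert_self j t)
      obtain ⟨L, hL⟩ := multi_update_linear hf hjs x
      have h0 : L = 0 := by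
        refine LinearMap.ext_on hz ?_
        rintro _ ⟨q, rfl⟩
        rw [← hL, LinearMap.zero_apply]
        refine ih (fun i hi => hts (Finset.mem_insert_of_mem hi)) _ fun i hi hit => ?_
        by_cases hij : i = j
        · subst hij; simp
        · rw [Function.update_of_ne hij]
          exact hx i hi (by simp [hij, hit])
      rw [← Function.update_eq_self j x, hL, h0, LinearMap.zero_apply]
  funext x
  exact key s (Finset.Subset.refl s) x fun i hi hni => absurd hi hni

/-- If all functions of a space of multilinear functions vanish on a set of tuples from a spanning
family, then the dimension is bounded by the number of the remaining tuples. -/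
theorem finrank_multi_le {Z : Type*} [Finite Z] {z : Z → A}
    (hz : Submodule.span K (Set.range z) = ⊤) (P : Set (s → Z))
    (h : ∀ f ∈ multi b deg s k, ∀ p ∉ P, ∀ x : ℕ → A, (∀ i : s, x i = z (p i)) → f x = 0) :
    Module.Finite K (multi b deg s k) ∧
    Module.finrank K (multi b deg s k) ≤ Nat.card P * Module.finrank K A := by
  classical
  have : Module.Finite K A := Module.Finite.of_basis b
  have : Fintype P := Fintype.ofFinite P
  let ex : P → ℕ → A := fun p i => if h : i ∈ s then z (p.1 ⟨i, h⟩) else 0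
  let R : multi b deg s k →ₗ[K] (P → A) :=
    (LinearMap.funLeft K A ex) ∘ₗ (multi b deg s k).subtype
  have hR : Function.Injective R := by
    rw [← LinearMap.ker_eq_bot, LinearMap.ker_eq_bot']
    rintro ⟨f, hf⟩ h0
    rw [Submodule.mk_eq_zero]
    refine multi_eq_zero hz hf fun x hx => ?_
    choose p hp using hx
    by_cases hP : (fun i : s => p i i.2) ∈ P
    · have := congrFun h0 ⟨_, hP⟩
      rw [multi_congr hf (y := ex ⟨_, hP⟩)]
      · exact this
      · intro i hi
        simp [ex, hi, hp]
    · exact h f hf _ hP x fun i => (hp i i.2).symm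
  refine ⟨Module.Finite.of_injective R hR, ?_⟩
  have := LinearMap.finrank_le_finrank_of_injective hR
  rwa [Module.finrank_pi_fintype, Finset.sum_const, Finset.card_univ, smul_eq_mul,
    ← Nat.card_eq_fintype_card] at this

instance finite_multi : Module.Finite K (multi b deg s k) :=
  (finrank_multi_le b.span_eq Set.univ fun _ _ p hp => absurd (Set.mem_univ p) hp).1

theorem IsWord.exists_var {j : ℕ} (hj : j ∉ s) (hf : IsWord b deg s k f) (hl : k = l + 1) :
    ∃ f', IsWord b deg (insert j s) l f' ∧ ∃ i, ∀ x, f x = f' (Function.update x j (b i)) := by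
  induction hf generalizing l with
  | nil => simp at hl
  | var i g s k f hi hf ih =>
    have hij : i ≠ j := by rintro rfl; simp at hj
    obtain ⟨f', h1, i', h2⟩ := ih (fun h => hj (Finset.mem_insert_of_mem h)) hl
    refine ⟨fun x => gproj b deg g (x i) * f' x, ?_, i', fun x => ?_⟩
    · rw [Finset.insert_comm]
      exact IsWord.var i g _ _ f' (by simp [hi, hij]) h1
    · beta_reduce
      rw [Function.update_of_ne hij, h2]
  | const i s k f hf ih =>
    obtain rfl : k = l := by simpa using hl
    refine ⟨_, IsWord.var j (deg i) s k f hj hf, i, fun x => ?_⟩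
    beta_reduce
    rw [Function.update_self, gproj_basis, if_pos rfl]
    congr 1
    refine hf.congr fun l hl => ?_
    rw [Function.update_of_ne]; rintro rfl; exact hj hl

theorem finrank_multi_succ_le {j : ℕ} (hj : j ∉ s) :
    Module.finrank K (multi b deg s (k + 1)) ≤
      Fintype.card I * Module.finrank K (multi b deg (insert j s) k) := by
  classical
  let N : I → Submodule K ((ℕ → A) → A) := fun i =>
    (multi b deg (insert j s) k).map (LinearMap.funLeft K A fun x => Function.update x j (b i))
  have h1 : multi b deg s (k + 1) ≤ ⨆ i, N i := by
    refine Submodule.span_le.mpr fun f hf => ?_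
    obtain ⟨f', hf', i, hi⟩ := IsWord.exists_var hj hf rfl
    refine Submodule.mem_iSup_of_mem i ⟨f', Submodule.subset_span hf', ?_⟩
    funext x
    exact (hi x).symm
  calc Module.finrank K (multi b deg s (k + 1)) ≤ Module.finrank K (⨆ i, N i : Submodule K _) :=
        Submodule.finrank_mono h1
    _ ≤ ∑ i, Module.finrank K (N i) := by
        have : ∀ t : Finset I, Module.finrank K (⨆ i ∈ t, N i : Submodule K _) ≤
            ∑ i ∈ t, Module.finrank K (N i) := by
          intro t
          induction t using Finset.induction with
          | empty => simp
          | insert i t hi ih =>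
            rw [Finset.iSup_insert, Finset.sum_insert hi]
            refine (Submodule.finrank_add_le_finrank_add_finrank _ _).trans ?_
            exact Nat.add_le_add_left ih _
        have h2 : (⨆ i ∈ (Finset.univ : Finset I), N i) = ⨆ i, N i := by simp
        exact h2 ▸ this Finset.univ
    _ ≤ ∑ _i : I, Module.finrank K (multi b deg (insert j s) k) :=
        Finset.sum_le_sum fun i _ => Submodule.finrank_map_le _ _
    _ = _ := by simp

theorem finrank_multi_range_le (n k : ℕ) :
    Module.finrank K (multi b deg (Finset.range n) k) ≤
      Fintype.card I ^ k * Module.finrank K (multi b deg (Finset.range (n + k)) 0) := by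
  induction k generalizing n with
  | zero => simp
  | succ k ih =>
    refine (finrank_multi_succ_le (Finset.notMem_range_self (n := n))).trans ?_
    rw [← Finset.range_add_one, pow_succ', mul_assoc]
    refine Nat.mul_le_mul_left _ ?_
    have := ih (n + 1)
    rwa [Nat.add_right_comm] at this

end Words

end GradedCodim

namespace GradedCodim

set_option linter.unusedSectionVars false

section Identification

theorem exists_isGradedBasis {F G A : Type*} [Field F] [Ring A] [Algebra F A]
    [FiniteDimensional F A] [Group G] [DecidableEq G] (𝒜 : G → Submodule F A)
    (hmul : ∀ g h : G, ∀ a ∈ 𝒜 g, ∀ b ∈ 𝒜 h, a * b ∈ 𝒜 (g * h))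
    (hdecomp : DirectSum.IsInternal 𝒜) :
    ∃ (N : ℕ) (b : Module.Basis (Fin N) F A) (deg : Fin N → G), IsGradedBasis b deg ∧
      ∀ g x, x ∈ 𝒜 g ↔ gproj b deg g x = x := by
  let v : ∀ g, Module.Basis (Fin (Module.finrank F (𝒜 g))) F (𝒜 g) := fun g =>
    Module.finBasis F (𝒜 g)
  let b₀ := hdecomp.collectedBasis v
  have : Finite (Σ g, Fin (Module.finrank F (𝒜 g))) := Module.Finite.finite_basis b₀
  obtain ⟨N, ⟨e⟩⟩ := Finite.exists_equiv_fin (Σ g, Fin (Module.finrank F (𝒜 g)))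
  let b := b₀.reindex e
  let deg : Fin N → G := fun i => (e.symm i).1
  have hbmem : ∀ i, b i ∈ 𝒜 (deg i) := fun i => by
    simp only [b, Module.Basis.reindex_apply, b₀, deg]
    exact hdecomp.collectedBasis_mem v _
  have hrepr : ∀ g, ∀ x ∈ 𝒜 g, ∀ k, b.repr x k ≠ 0 → deg k = g := by
    intro g x hx k hk
    by_contra hne
    apply hk
    simp only [b, Module.Basis.repr_reindex, Finsupp.mapDomain_equiv_apply]
    exact hdecomp.collectedBasis_repr_of_mem_ne v (Ne.symm hne) hx
  refine ⟨N, b, deg, fun i j k hk => hrepr _ _ (hmul _ _ _ (hbmem i) _ (hbmem j)) k hk, ?_⟩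
  intro g x
  have hg : ∀ x, gproj b deg g x = ∑ k, b.repr x k • if deg k = g then b k else 0 := fun x => by
    conv_lhs => rw [← b.sum_repr x, map_sum]
    simp_rw [map_smul, gproj_basis]
  constructor
  · intro hx
    rw [hg]
    conv_rhs => rw [← b.sum_repr x]
    refine Finset.sum_congr rfl fun k _ => ?_
    by_cases h : b.repr x k = 0
    · simp [h]
    · rw [if_pos (hrepr g x hx k h)]
  · intro hx
    rw [← hx, hg]
    refine Submodule.sum_mem _ fun k _ => Submodule.smul_mem _ _ ?_
    split_ifs with h
    · exact h ▸ hbmem k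
    · exact Submodule.zero_mem _

variable {K A G I : Type*} [Field K] [Ring A] [Algebra K A] [Group G] [DecidableEq G]
  [Fintype I] {b : Module.Basis I K A} {deg : I → G}

/-- Evaluation of noncommutative polynomials at the homogeneous components of `x : ℕ → A`. -/
noncomputable def evalHom (b : Module.Basis I K A) (deg : I → G) :
    FreeAlgebra K (ℕ × G) →ₗ[K] ((ℕ → A) → A) where
  toFun f x := FreeAlgebra.lift K (fun p : ℕ × G => gproj b deg p.2 (x p.1)) f
  map_add' f f' := by ext x; simp
  map_smul' c f := by ext x; simp

theorem isWord_list (l : List (ℕ × G)) (hl : (l.map Prod.fst).Nodup) :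
    IsWord b deg (l.map Prod.fst).toFinset 0
      fun x => (l.map fun p => gproj b deg p.2 (x p.1)).prod := by
  induction l with
  | nil => exact IsWord.nil
  | cons p l ih =>
    rw [List.map_cons, List.nodup_cons] at hl
    simp only [List.map_cons, List.prod_cons, List.toFinset_cons]
    exact IsWord.var _ _ _ _ _ (by simpa using hl.1) (ih hl.2)

theorem IsWord.exists_list {s : Finset ℕ} {f : (ℕ → A) → A} (hf : IsWord b deg s 0 f) :
    ∃ l : List (ℕ × G), (l.map Prod.fst).Nodup ∧ (l.map Prod.fst).toFinset = s ∧
      f = fun x => (l.map fun p => gproj b deg p.2 (x p.1)).prod := by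
  generalize hk : 0 = k at hf
  induction hf with
  | nil => exact ⟨[], by simp, by simp, by simp⟩
  | var i g s k f hi hf ih =>
    obtain ⟨l, h1, h2, h3⟩ := ih hk
    refine ⟨(i, g) :: l, ?_, ?_, ?_⟩
    · rw [List.map_cons, List.nodup_cons]
      refine ⟨fun h => hi ?_, h1⟩
      rw [← h2]; simpa using h
    · simp [← h2]
    · simp [h3]
  | const => simp at hk

theorem map_evalHom (n : ℕ) :
    (multilinearGradedPolys K G n).map (evalHom b deg) = multi b deg (Finset.range n) 0 := by
  rw [multilinearGradedPolys, Submodule.map_span, multi]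
  have hE : ∀ l : List (ℕ × G), evalHom b deg ((l.map (FreeAlgebra.ι K)).prod) =
      fun x => (l.map fun p => gproj b deg p.2 (x p.1)).prod := by
    intro l
    ext x
    simp [evalHom, map_list_prod, List.map_map, Function.comp_def]
  have hof : ∀ (σ : Equiv.Perm (Fin n)) (g : Fin n → G),
      (List.ofFn fun k => FreeAlgebra.ι K (((σ k : Fin n) : ℕ), g k)) =
      (List.ofFn fun k => (((σ k : Fin n) : ℕ), g k)).map (FreeAlgebra.ι K) := by
    intro σ g
    rw [List.map_ofFn]; rfl
  congr 1
  ext f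
  constructor
  · rintro ⟨_, ⟨σ, g, rfl⟩, rfl⟩
    rw [hof, hE]
    have h1 : (List.ofFn fun k => (((σ k : Fin n) : ℕ), g k)).map Prod.fst =
        List.ofFn fun k => ((σ k : Fin n) : ℕ) := by rw [List.map_ofFn]; rfl
    have := isWord_list (b := b) (deg := deg) (List.ofFn fun k => (((σ k : Fin n) : ℕ), g k)) (by
      rw [h1, List.nodup_ofFn]
      exact Fin.val_injective.comp σ.injective)
    have h2 : ((List.ofFn fun k => (((σ k : Fin n) : ℕ), g k)).map Prod.fst).toFinset =
        Finset.range n := by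
      rw [h1]
      ext i
      simp only [List.mem_toFinset, List.mem_ofFn, Finset.mem_range]
      constructor
      · rintro ⟨k, rfl⟩; exact (σ k).2
      · intro hi; exact ⟨σ.symm ⟨i, hi⟩, by simp⟩
    rwa [h2] at this
  · intro hf
    obtain ⟨l, h1, h2, rfl⟩ := IsWord.exists_list hf
    have hlen : l.length = n := by
      have := List.toFinset_card_of_nodup h1
      rw [h2] at this
      simpa using this.symm
    subst hlen
    have hlt : ∀ k : Fin l.length, (l.get k).1 < l.length := fun k => by
      rw [← Finset.mem_range, ← h2, List.mem_toFinset]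
      exact List.mem_map_of_mem (List.get_mem l k)
    let σ₀ : Fin l.length → Fin l.length := fun k => ⟨(l.get k).1, hlt k⟩
    have hinj : Function.Injective σ₀ := by
      intro i j hij
      have h3 : (l.get i).1 = (l.get j).1 := congrArg Fin.val hij
      have h4 := List.nodup_iff_injective_get.mp h1
      have := @h4 ⟨i, by simp⟩ ⟨j, by simp⟩ (by simpa using h3)
      simpa [Fin.ext_iff] using this
    refine ⟨_, ⟨Equiv.ofBijective σ₀ (Finite.injective_iff_bijective.mp hinj),
      fun k => (l.get k).2, rfl⟩, ?_⟩
    rw [hof, hE]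
    have : (List.ofFn fun k : Fin l.length =>
        ((((Equiv.ofBijective σ₀ (Finite.injective_iff_bijective.mp hinj)) k :
          Fin l.length) : ℕ), (l.get k).2)) = l := by
      conv_rhs => rw [← List.ofFn_get l]
      rfl
    rw [this]

theorem gradedCodim_eq (𝒜 : G → Submodule K A) (hA : ∀ g x, x ∈ 𝒜 g ↔ gproj b deg g x = x)
    (n : ℕ) :
    gradedCodim K 𝒜 n = Module.finrank K (multi b deg (Finset.range n) 0) := by
  have hker : LinearMap.ker (evalHom b deg) = gradedIdentities K 𝒜 := by
    ext f
    constructor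
    · intro hf φ hφ
      let x : ℕ → A := fun i => ∑ g ∈ Finset.univ.image deg, φ (FreeAlgebra.ι K (i, g))
      have hx : φ = FreeAlgebra.lift K (fun p : ℕ × G => gproj b deg p.2 (x p.1)) := by
        refine FreeAlgebra.hom_ext ?_
        funext ⟨i, g⟩
        simp only [Function.comp_apply, FreeAlgebra.lift_ι_apply, x, map_sum]
        have h1 : ∀ h, gproj b deg g (φ (FreeAlgebra.ι K (i, h))) =
            if g = h then φ (FreeAlgebra.ι K (i, h)) else 0 := by
          intro h
          have := (hA h _).mp (hφ i h)
          rw [← this, gproj_gproj]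
        simp_rw [h1]
        rw [Finset.sum_ite_eq]
        split_ifs with hg
        · rfl
        · rw [← (hA g _).mp (hφ i g)]
          have : gproj b deg g = 0 := b.ext fun j => by
            rw [gproj_basis, if_neg]
            · rfl
            · rintro rfl; simp at hg
          rw [this, LinearMap.zero_apply]
      rw [hx]
      exact congrFun hf x
    · intro hf
      rw [LinearMap.mem_ker]
      ext x
      refine hf _ fun i g => ?_
      rw [FreeAlgebra.lift_ι_apply, hA, gproj_gproj, if_pos rfl]
  have hran : LinearMap.range (evalHom b deg ∘ₗ (multilinearGradedPolys K G n).subtype) =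
      (multilinearGradedPolys K G n).map (evalHom b deg) := by
    rw [LinearMap.range_comp, Submodule.range_subtype]
  rw [gradedCodim, ← map_evalHom (b := b) (deg := deg), ← hker, ← LinearMap.ker_comp, ← hran]
  exact LinearEquiv.finrank_eq (LinearMap.quotKerEquivRange _)

end Identification

end GradedCodim

namespace GradedCodim

set_option linter.unusedSectionVars false

section BaseChange

open TensorProduct

section Coordinates

variable {K A G I : Type*} [Field K] [Ring A] [Algebra K A] [Group G] [DecidableEq G]
  [Fintype I] (b : Module.Basis I K A) (deg : I → G)

theorem finrank_multi_zero_eq (s : Finset ℕ) :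
    Module.finrank K (multi b deg s 0) = Module.finrank K (Submodule.span K (Set.range
      fun (l : {l : List (ℕ × G) // (l.map Prod.fst).Nodup ∧ (l.map Prod.fst).toFinset = s})
        (y : (s → I) × I) => b.repr (l.1.map fun p => gproj b deg p.2
          (if h : p.1 ∈ s then b (y.1 ⟨p.1, h⟩) else 0)).prod y.2)) := by
  classical
  let ex : (s → I) → ℕ → A := fun p i => if h : i ∈ s then b (p ⟨i, h⟩) else 0
  let w : {l : List (ℕ × G) // (l.map Prod.fst).Nodup ∧ (l.map Prod.fst).toFinset = s} →
      (ℕ → A) → A := fun l x => (l.1.map fun p => gproj b deg p.2 (x p.1)).prod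
  have hspan : multi b deg s 0 = Submodule.span K (Set.range w) := by
    rw [multi]
    congr 1
    ext f
    constructor
    · intro hf
      obtain ⟨l, h1, h2, rfl⟩ := IsWord.exists_list hf
      exact ⟨⟨l, h1, h2⟩, rfl⟩
    · rintro ⟨⟨l, h1, h2⟩, rfl⟩
      have := isWord_list (b := b) (deg := deg) l h1
      rwa [h2] at this
  let R : ((ℕ → A) → A) →ₗ[K] ((s → I) × I → K) :=
    LinearMap.pi fun y => b.coord y.2 ∘ₗ LinearMap.proj (ex y.1)
  have hR : Set.InjOn R (multi b deg s 0) := by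
    intro f hf f' hf' h
    rw [← sub_eq_zero]
    refine multi_eq_zero b.span_eq (Submodule.sub_mem _ hf hf') fun x hx => ?_
    choose p hp using hx
    have : (f - f') x = (f - f') (ex fun i => p i i.2) :=
      multi_congr (Submodule.sub_mem _ hf hf') fun i hi => by simp [ex, hi, hp]
    rw [this, ← b.repr.map_eq_zero_iff]
    ext k
    have h2 := congrFun h (fun i => p i i.2, k)
    rw [Pi.sub_apply, map_sub, Finsupp.sub_apply]
    exact sub_eq_zero.mpr h2
  have h3 : Set.range (fun (l : {l : List (ℕ × G) //
        (l.map Prod.fst).Nodup ∧ (l.map Prod.fst).toFinset = s})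
        (y : (s → I) × I) => b.repr (l.1.map fun p => gproj b deg p.2
          (if h : p.1 ∈ s then b (y.1 ⟨p.1, h⟩) else 0)).prod y.2) = R '' Set.range w := by
    rw [← Set.range_comp]
    rfl
  rw [h3, ← Submodule.map_span, ← hspan]
  have h4 : Function.Injective (R ∘ₗ (multi b deg s 0).subtype) := fun f f' h =>
    Subtype.ext (hR f.2 f'.2 h)
  have h5 := LinearMap.finrank_range_of_inj h4
  rw [LinearMap.range_comp, Submodule.range_subtype] at h5
  exact h5.symm

end Coordinates

variable {F A G I : Type*} (K : Type*) [Field F] [Field K] [Algebra F K] [Ring A] [Algebra F A]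
  [Group G] [DecidableEq G] [Fintype I] (b : Module.Basis I F A) (deg : I → G)

theorem basis_repr_one_tmul (a : A) (k : I) :
    (Algebra.TensorProduct.basis K b).repr ((1 : K) ⊗ₜ[F] a) k = algebraMap F K (b.repr a k) := by
  simp [Algebra.TensorProduct.basis_repr_tmul]

theorem IsGradedBasis.baseChange (hb : IsGradedBasis b deg) :
    IsGradedBasis (Algebra.TensorProduct.basis K b) deg := by
  intro i j k hk
  refine hb i j k fun h0 => hk ?_
  rw [Algebra.TensorProduct.basis_apply, Algebra.TensorProduct.basis_apply,
    Algebra.TensorProduct.tmul_mul_tmul, one_mul, basis_repr_one_tmul, h0, map_zero]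

theorem gproj_one_tmul (g : G) (a : A) :
    gproj (Algebra.TensorProduct.basis K b) deg g ((1 : K) ⊗ₜ[F] a) =
      (1 : K) ⊗ₜ[F] gproj b deg g a := by
  have h : ((gproj (Algebra.TensorProduct.basis K b) deg g).restrictScalars F) ∘ₗ
      TensorProduct.mk F K A 1 = TensorProduct.mk F K A 1 ∘ₗ gproj b deg g := by
    refine b.ext fun i => ?_
    have := gproj_basis (Algebra.TensorProduct.basis K b) deg g i
    rw [Algebra.TensorProduct.basis_apply] at this
    simp only [LinearMap.comp_apply, TensorProduct.mk_apply, LinearMap.restrictScalars_apply,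
      gproj_basis, this]
    split_ifs <;> simp
  exact LinearMap.congr_fun h a

theorem finrank_multi_baseChange (s : Finset ℕ) :
    Module.finrank K (multi (Algebra.TensorProduct.basis K b) deg s 0) =
      Module.finrank F (multi b deg s 0) := by
  rw [finrank_multi_zero_eq, finrank_multi_zero_eq b]
  rw [← finrank_span_map_algebraMap F K]
  refine congrArg (fun w => Module.finrank K (Submodule.span K (Set.range w))) ?_
  funext l y
  rw [← basis_repr_one_tmul]
  congr 2
  have h : ∀ l : List A, ((1 : K) ⊗ₜ[F] l.prod) = (l.map fun a => (1 : K) ⊗ₜ[F] a).prod :=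
    fun l => map_list_prod (Algebra.TensorProduct.includeRight : A →ₐ[F] K ⊗[F] A) l
  rw [h, List.map_map]
  congr 2
  funext p
  rw [Function.comp_apply, ← gproj_one_tmul]
  congr 1
  split_ifs
  · simp
  · simp

end BaseChange

end GradedCodim

theorem tendsto_rpow_one_div_of_le {c : ℕ → ℕ} {d C D : ℕ}
    (h₁ : ∀ᶠ n in Filter.atTop, c n ≤ C * n ^ D * d ^ n)
    (h₂ : ∀ᶠ n in Filter.atTop, d ^ n ≤ C * n ^ D * c n) :
    Filter.Tendsto (fun n : ℕ => (c n : ℝ) ^ (1 / (n : ℝ))) Filter.atTop (nhds (d : ℝ)) := by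
  let a : ℕ → ℝ := fun n => ((C + 1 : ℕ) : ℝ) * (n : ℝ) ^ D
  have ha : Filter.Tendsto (fun n : ℕ => a n ^ (1 / (n : ℝ))) Filter.atTop (nhds 1) := by
    have h3 : Filter.Tendsto (fun n : ℕ => ((C + 1 : ℕ) : ℝ) ^ (1 / (n : ℝ)) *
        ((n : ℝ) ^ (1 / (n : ℝ))) ^ D) Filter.atTop (nhds (1 * 1 ^ D)) := by
      refine Filter.Tendsto.mul ?_ (Filter.Tendsto.pow ?_ D)
      · have h0 : Filter.Tendsto (fun n : ℕ => 1 / (n : ℝ)) Filter.atTop (nhds 0) :=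
          tendsto_one_div_atTop_nhds_zero_nat
        have := (tendsto_const_nhds (x := ((C + 1 : ℕ) : ℝ))).rpow h0
          (Or.inl (by positivity))
        rwa [Real.rpow_zero] at this
      · exact tendsto_rpow_div.comp tendsto_natCast_atTop_atTop
    rw [one_pow, mul_one] at h3
    refine h3.congr fun n => ?_
    rw [Real.mul_rpow (by positivity) (by positivity), ← Real.rpow_natCast, ← Real.rpow_natCast,
      ← Real.rpow_mul (by positivity), ← Real.rpow_mul (by positivity), mul_comm (D : ℝ)]
  have hd : ∀ n : ℕ, 1 ≤ n → ((d : ℝ) ^ n) ^ (1 / (n : ℝ)) = d := fun n hn => by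
    rw [one_div, Real.pow_rpow_inv_natCast (by positivity) (by omega)]
  refine tendsto_of_tendsto_of_tendsto_of_le_of_le'
    (g := fun n : ℕ => (d : ℝ) / a n ^ (1 / (n : ℝ)))
    (h := fun n : ℕ => a n ^ (1 / (n : ℝ)) * d) ?_ ?_ ?_ ?_
  · have := (tendsto_const_nhds (x := (d : ℝ))).div ha one_ne_zero
    rwa [div_one] at this
  · simpa using ha.mul_const (d : ℝ)
  · filter_upwards [h₂, Filter.eventually_ge_atTop 1] with n hn h1
    have hn0 : (0 : ℝ) < n := by exact_mod_cast h1
    have hapos : 0 < a n := by positivity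
    rw [div_le_iff₀ (by positivity), ← Real.mul_rpow (by positivity) (by positivity)]
    conv_lhs => rw [← hd n h1]
    refine Real.rpow_le_rpow (by positivity) ?_ (by positivity)
    have : (d : ℝ) ^ n ≤ C * n ^ D * c n := by exact_mod_cast hn
    refine this.trans ?_
    rw [mul_comm (c n : ℝ)]
    simp only [a]
    gcongr
    simp
  · filter_upwards [h₁, Filter.eventually_ge_atTop 1] with n hn h1
    have hn0 : (0 : ℝ) < n := by exact_mod_cast h1
    have hapos : 0 < a n := by positivity
    conv_rhs => rw [← hd n h1]
    rw [← Real.mul_rpow (by positivity) (by positivity)]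
    refine Real.rpow_le_rpow (by positivity) ?_ (by positivity)
    have : (c n : ℝ) ≤ C * n ^ D * d ^ n := by exact_mod_cast hn
    refine this.trans ?_
    simp only [a]
    gcongr
    simp

open Polynomial in
/-- In characteristic zero, an endomorphism all of whose powers have trace zero is nilpotent. -/
theorem isNilpotent_of_trace_pow_eq_zero {K V : Type*} [Field K] [CharZero K] [AddCommGroup V]
    [Module K V] [FiniteDimensional K V] (f : Module.End K V)
    (h : ∀ k : ℕ, LinearMap.trace K V (f ^ (k + 1)) = 0) : IsNilpotent f := by
  have hp : X * minpoly K f ≠ 0 :=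
    mul_ne_zero X_ne_zero (minpoly.ne_zero (Algebra.IsIntegral.isIntegral f))
  obtain ⟨q, hq, hnd⟩ := exists_eq_pow_rootMultiplicity_mul_and_not_dvd _ hp (0 : K)
  set k := rootMultiplicity (0 : K) (X * minpoly K f) with hk
  rw [C_0, sub_zero] at hq hnd
  have hk1 : 0 < k := by
    rw [hk, rootMultiplicity_pos hp]
    simp
  obtain ⟨k', hk'⟩ : ∃ k', k = k' + 1 := ⟨k - 1, by omega⟩
  have hco : IsCoprime (X ^ k) q :=
    IsCoprime.pow_left ((Polynomial.irreducible_X.coprime_iff_not_dvd).mpr hnd)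
  obtain ⟨u, v, huv⟩ := hco
  have hann : aeval f (X ^ k * q) = 0 := by
    rw [← hq, map_mul, minpoly.aeval, mul_zero]
  have htr : ∀ w : K[X], LinearMap.trace K V (aeval f (w * X)) = 0 := by
    intro w
    induction w using Polynomial.induction_on' with
    | add p q hp hq => rw [add_mul, map_add, map_add, hp, hq, add_zero]
    | monomial n a =>
      rw [Polynomial.monomial_mul_X, Polynomial.aeval_monomial, ← Algebra.smul_def, map_smul, h,
        smul_zero]
  have he : IsIdempotentElem (aeval f (u * X ^ k)) := by
    have h1 : u * X ^ k * (u * X ^ k) = u * X ^ k - u * v * (X ^ k * q) := by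
      linear_combination (u * X ^ k) * huv
    rw [IsIdempotentElem, ← map_mul, h1, map_sub, map_mul _ (u * v), hann, mul_zero, sub_zero]
  have he0 : aeval f (u * X ^ k) = 0 := by
    have h2 : LinearMap.trace K V (aeval f (u * X ^ k)) = 0 := by
      rw [hk', pow_succ, ← mul_assoc]; exact htr _
    exact (LinearMap.IsIdempotentElem.trace_eq_zero_iff he).mp h2
  refine ⟨k, ?_⟩
  have h3 : (X ^ k : K[X]) = X ^ k * (u * X ^ k) + v * (X ^ k * q) := by
    linear_combination (-X ^ k) * huv
  have h4 := congrArg (aeval f) h3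
  rw [map_add, map_mul, he0, map_mul _ v, hann, mul_zero, mul_zero, add_zero, map_pow,
    aeval_X] at h4
  exact h4

namespace GradedCodim

set_option linter.unusedSectionVars false

section TraceForm

variable {K A G I : Type*} [Field K] [Ring A] [Algebra K A] [Group G] [DecidableEq G]
  [Fintype I] (b : Module.Basis I K A) (deg : I → G)

/-- Two-sided graded ideals. -/
structure IsGradedIdeal (P : Submodule K A) : Prop where
  mul_mem_left (a : A) {x : A} (hx : x ∈ P) : a * x ∈ P
  mul_mem_right (a : A) {x : A} (hx : x ∈ P) : x * a ∈ P
  gproj_mem (g : G) {x : A} (hx : x ∈ P) : gproj b deg g x ∈ P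

variable {b deg}

theorem isGradedIdeal_top : IsGradedIdeal b deg (⊤ : Submodule K A) :=
  ⟨fun _ _ _ => trivial, fun _ _ _ => trivial, fun _ _ _ => trivial⟩

theorem isGradedIdeal_bot : IsGradedIdeal b deg (⊥ : Submodule K A) :=
  ⟨fun _ _ h => by simp_all, fun _ _ h => by simp_all, fun _ _ h => by simp_all⟩

theorem IsGradedIdeal.inf {P Q : Submodule K A} (hP : IsGradedIdeal b deg P)
    (hQ : IsGradedIdeal b deg Q) : IsGradedIdeal b deg (P ⊓ Q) :=
  ⟨fun a _ h => ⟨hP.mul_mem_left a h.1, hQ.mul_mem_left a h.2⟩,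
    fun a _ h => ⟨hP.mul_mem_right a h.1, hQ.mul_mem_right a h.2⟩,
    fun g _ h => ⟨hP.gproj_mem g h.1, hQ.gproj_mem g h.2⟩⟩

theorem IsGradedIdeal.sup {P Q : Submodule K A} (hP : IsGradedIdeal b deg P)
    (hQ : IsGradedIdeal b deg Q) : IsGradedIdeal b deg (P ⊔ Q) where
  mul_mem_left a x h := by
    obtain ⟨y, hy, z, hz, rfl⟩ := Submodule.mem_sup.mp h
    rw [mul_add]
    exact Submodule.add_mem_sup (hP.mul_mem_left a hy) (hQ.mul_mem_left a hz)
  mul_mem_right a x h := by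
    obtain ⟨y, hy, z, hz, rfl⟩ := Submodule.mem_sup.mp h
    rw [add_mul]
    exact Submodule.add_mem_sup (hP.mul_mem_right a hy) (hQ.mul_mem_right a hz)
  gproj_mem g x h := by
    obtain ⟨y, hy, z, hz, rfl⟩ := Submodule.mem_sup.mp h
    rw [map_add]
    exact Submodule.add_mem_sup (hP.gproj_mem g hy) (hQ.gproj_mem g hz)

theorem IsGradedIdeal.iInf {ι : Type*} {P : ι → Submodule K A}
    (hP : ∀ i, IsGradedIdeal b deg (P i)) : IsGradedIdeal b deg (⨅ i, P i) where
  mul_mem_left a x h := by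
    rw [Submodule.mem_iInf] at h ⊢
    exact fun i => (hP i).mul_mem_left a (h i)
  mul_mem_right a x h := by
    rw [Submodule.mem_iInf] at h ⊢
    exact fun i => (hP i).mul_mem_right a (h i)
  gproj_mem g x h := by
    rw [Submodule.mem_iInf] at h ⊢
    exact fun i => (hP i).gproj_mem g (h i)

/-- Left multiplication on the quotient by a graded ideal. -/
def quotLeft {P : Submodule K A} (hP : IsGradedIdeal b deg P) :
    A →ₐ[K] Module.End K (A ⧸ P) :=
  AlgHom.ofLinearMap
    { toFun a := P.mapQ P (LinearMap.mulLeft K a) fun _ hx => hP.mul_mem_left a hx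
      map_add' a a' := by
        refine LinearMap.ext fun x => ?_
        obtain ⟨x, rfl⟩ := P.mkQ_surjective x
        exact congrArg P.mkQ (add_mul a a' x)
      map_smul' c a := by
        refine LinearMap.ext fun x => ?_
        obtain ⟨x, rfl⟩ := P.mkQ_surjective x
        exact congrArg P.mkQ (smul_mul_assoc c a x) }
    (by
      refine LinearMap.ext fun x => ?_
      obtain ⟨x, rfl⟩ := P.mkQ_surjective x
      simp)
    (fun a a' => by
      refine LinearMap.ext fun x => ?_
      obtain ⟨x, rfl⟩ := P.mkQ_surjective x
      exact congrArg P.mkQ (mul_assoc a a' x))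

theorem quotLeft_mkQ {P : Submodule K A} (hP : IsGradedIdeal b deg P) (a x : A) :
    quotLeft hP a (P.mkQ x) = P.mkQ (a * x) := rfl

theorem quotLeft_eq_zero_iff {P : Submodule K A} (hP : IsGradedIdeal b deg P) (a : A) :
    quotLeft hP a = 0 ↔ a ∈ P := by
  constructor
  · intro h
    have := LinearMap.congr_fun h (P.mkQ 1)
    rw [quotLeft_mkQ, mul_one, LinearMap.zero_apply] at this
    simpa using this
  · intro h
    refine LinearMap.ext fun x => ?_
    obtain ⟨x, rfl⟩ := P.mkQ_surjective x
    rw [quotLeft_mkQ, LinearMap.zero_apply]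
    simpa using hP.mul_mem_right x h

/-- The trace of left multiplication on the quotient by a graded ideal. -/
noncomputable def quotTrace {P : Submodule K A} (hP : IsGradedIdeal b deg P) : A →ₗ[K] K :=
  LinearMap.trace K (A ⧸ P) ∘ₗ (quotLeft hP).toLinearMap

theorem quotTrace_mul_comm {P : Submodule K A} (hP : IsGradedIdeal b deg P) (u v : A) :
    quotTrace hP (u * v) = quotTrace hP (v * u) := by
  simp only [quotTrace, LinearMap.comp_apply, AlgHom.toLinearMap_apply, map_mul]
  exact LinearMap.trace_mul_comm K _ _

theorem quotTrace_gproj (hb : IsGradedBasis b deg) {P : Submodule K A}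
    (hP : IsGradedIdeal b deg P) {g : G} (hg : g ≠ 1) (w : A) :
    quotTrace hP (gproj b deg g w) = 0 := by
  let p : G → Module.End K (A ⧸ P) := fun h =>
    P.mapQ P (gproj b deg h) fun x hx => hP.gproj_mem h hx
  have hp : ∀ h x, p h (P.mkQ x) = P.mkQ (gproj b deg h x) := fun h x => rfl
  let L := quotLeft hP (gproj b deg g w)
  have h1 : ∑ h ∈ Finset.univ.image deg, p h * L = L := by
    refine LinearMap.ext fun x => ?_
    obtain ⟨x, rfl⟩ := P.mkQ_surjective x
    simp only [LinearMap.sum_apply, Module.End.mul_apply, L, quotLeft_mkQ, hp]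
    rw [← map_sum, sum_gproj]
  have h2 : ∀ h, p h * L = p h * (p h * L) := by
    intro h
    refine LinearMap.ext fun x => ?_
    obtain ⟨x, rfl⟩ := P.mkQ_surjective x
    simp only [Module.End.mul_apply, L, quotLeft_mkQ, hp, gproj_gproj, if_true]
  have h3 : ∀ h, p h * L * p h = 0 := by
    intro h
    refine LinearMap.ext fun x => ?_
    obtain ⟨x, rfl⟩ := P.mkQ_surjective x
    simp only [Module.End.mul_apply, L, quotLeft_mkQ, hp, LinearMap.zero_apply]
    rw [hb.gproj_gproj_mul, gproj_gproj, if_neg, mul_zero, map_zero]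
    intro h4
    exact hg (by simpa using h4)
  change LinearMap.trace K (A ⧸ P) L = 0
  rw [← h1, map_sum]
  refine Finset.sum_eq_zero fun h _ => ?_
  rw [h2, LinearMap.trace_mul_comm, h3, map_zero]

theorem quotTrace_gproj_one (hb : IsGradedBasis b deg) {P : Submodule K A}
    (hP : IsGradedIdeal b deg P) (w : A) :
    quotTrace hP (gproj b deg 1 w) = quotTrace hP w := by
  conv_rhs => rw [← sum_gproj b deg w, map_sum]
  by_cases h1 : (1 : G) ∈ Finset.univ.image deg
  · rw [Finset.sum_eq_single_of_mem 1 h1]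
    exact fun g _ hg => quotTrace_gproj hb hP hg w
  · rw [Finset.sum_eq_zero fun g hg => quotTrace_gproj hb hP (by rintro rfl; exact h1 hg) w]
    have : gproj b deg (1 : G) = 0 := b.ext fun j => by
      rw [gproj_basis, if_neg]
      · rfl
      · intro h; exact h1 (h ▸ Finset.mem_image_of_mem _ (Finset.mem_univ j))
    rw [this, LinearMap.zero_apply, map_zero]

/-- The orthogonal complement of `M` with respect to the trace form of `A ⧸ P`. -/
noncomputable def perp {P : Submodule K A} (hP : IsGradedIdeal b deg P) (M : Submodule K A) :
    Submodule K A where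
  carrier := {u | ∀ v ∈ M, quotTrace hP (u * v) = 0}
  add_mem' h h' v hv := by rw [add_mul, map_add, h v hv, h' v hv, add_zero]
  zero_mem' v _ := by rw [zero_mul, map_zero]
  smul_mem' c u h v hv := by rw [smul_mul_assoc, map_smul, h v hv, smul_zero]

theorem isGradedIdeal_perp (hb : IsGradedBasis b deg) {P M : Submodule K A}
    (hP : IsGradedIdeal b deg P) (hM : IsGradedIdeal b deg M) :
    IsGradedIdeal b deg (perp hP M) where
  mul_mem_left a u hu v hv := by
    rw [mul_assoc, quotTrace_mul_comm, mul_assoc]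
    exact hu _ (hM.mul_mem_right a hv)
  mul_mem_right a u hu v hv := by
    rw [mul_assoc]
    exact hu _ (hM.mul_mem_left a hv)
  gproj_mem g u hu v hv := by
    rw [← quotTrace_gproj_one hb, hb.gproj_gproj_mul, mul_one]
    have := hu _ (hM.gproj_mem g⁻¹ hv)
    rwa [← quotTrace_gproj_one hb, hb.gproj_mul_gproj, one_mul, inv_inv] at this

theorem exists_pow_mem_of_mem_perp [CharZero K] {P M : Submodule K A}
    (hP : IsGradedIdeal b deg P) (hM : IsGradedIdeal b deg M) {u : A} (hu : u ∈ M)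
    (hu' : u ∈ perp hP M) : ∃ k, u ^ k ∈ P := by
  have : Module.Finite K A := Module.Finite.of_basis b
  have h1 : IsNilpotent (quotLeft hP (u * u)) := by
    refine isNilpotent_of_trace_pow_eq_zero _ fun k => ?_
    rw [← map_pow, pow_succ', mul_assoc]
    refine hu' _ ?_
    exact hM.mul_mem_right _ hu
  obtain ⟨k, hk⟩ := h1
  refine ⟨2 * k, ?_⟩
  rw [← map_pow, quotLeft_eq_zero_iff] at hk
  rwa [pow_mul, sq]

theorem mem_perp_of_nil {P M : Submodule K A} (hP : IsGradedIdeal b deg P) {u : A}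
    (h : ∀ v ∈ M, IsNilpotent (u * v)) : u ∈ perp hP M := by
  have : Module.Finite K A := Module.Finite.of_basis b
  intro v hv
  have h1 : IsNilpotent (quotLeft hP (u * v)) := (h v hv).map (quotLeft hP)
  exact (LinearMap.isNilpotent_trace_of_isNilpotent h1).eq_zero

end TraceForm

end GradedCodim

namespace GradedCodim

set_option linter.unusedSectionVars false

/-- Density theorem: rank one maps into a simple quotient module are induced by scalars. -/
theorem exists_smul_sub_mem_of_isCoatom {K R M : Type*} [Field K] [IsAlgClosed K] [Ring R]
    [Algebra K R] [AddCommGroup M] [Module K M] [Module R M] [IsScalarTower K R M]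
    [Module.Finite K M] {P : Submodule R M} (hP : IsCoatom P) (β : M →ₗ[K] K)
    (hβ : ∀ x ∈ P, β x = 0) (e : M) : ∃ r : R, ∀ x, r • x - β x • e ∈ P := by
  classical
  let b := Module.finBasis K M
  have hsimple : IsSimpleModule R (M ⧸ P) := isSimpleModule_iff_isCoatom.mpr hP
  have hmk : Function.Surjective P.mkQ := P.mkQ_surjective
  have : Module.Finite K (M ⧸ P) :=
    Module.Finite.of_surjective (P.mkQ.restrictScalars K) hmk
  let β' : (M ⧸ P) →ₗ[K] K := (P.restrictScalars K).liftQ β fun x hx => hβ x hx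
  have hS := (IsSimpleModule.algebraMap_end_bijective_of_isAlgClosed (A := R)
    (V := M ⧸ P) K).2
  let f : Module.End (Module.End R (M ⧸ P)) (M ⧸ P) :=
    { toFun m := β' m • P.mkQ e
      map_add' m m' := by rw [map_add, add_smul]
      map_smul' c m := by
        obtain ⟨k, rfl⟩ := hS c
        have : ∀ y : M ⧸ P, algebraMap K (Module.End R (M ⧸ P)) k • y = k • y :=
          fun y => rfl
        rw [this, RingHom.id_apply, this, map_smul, smul_assoc] }
  obtain ⟨r, hr⟩ := jacobson_density f (Finset.univ.image fun i => P.mkQ (b i))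
  refine ⟨r, fun x => ?_⟩
  have h1 : ∀ i, r • b i - β (b i) • e ∈ P := by
    intro i
    have h2 := hr (P.mkQ (b i)) (Finset.mem_image_of_mem _ (Finset.mem_univ i))
    have h3 : P.mkQ (β (b i) • e) = P.mkQ (r • b i) := h2
    rw [← sub_eq_zero, ← map_sub, ← LinearMap.mem_ker, Submodule.ker_mkQ] at h3
    rw [← neg_mem_iff, neg_sub]
    exact h3
  have h4 : r • x - β x • e = ∑ i, b.repr x i • (r • b i - β (b i) • e) := by
    conv_lhs => rw [← b.sum_repr x]
    simp only [map_sum, map_smul, smul_sub, Finset.sum_sub_distrib, Finset.sum_smul, mul_smul,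
      smul_eq_mul, Finset.smul_sum, smul_comm r]
  rw [h4]
  exact P.sum_mem fun i _ => (P.restrictScalars K).smul_mem _ (h1 i)

section Density

variable {K A G I : Type*} [Field K] [Ring A] [Algebra K A] [Group G] [DecidableEq G]
  [Fintype I] (b : Module.Basis I K A) (deg : I → G)

/-- The algebra generated by multiplications and projections onto homogeneous components. -/
def opAlg : Subalgebra K (Module.End K A) :=
  Algebra.adjoin K (Set.range (LinearMap.mulLeft K) ∪ Set.range (LinearMap.mulRight K) ∪
    Set.range (gproj b deg))

variable {b deg}

theorem mulLeft_mem_opAlg (a : A) : LinearMap.mulLeft K a ∈ opAlg b deg :=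
  Algebra.subset_adjoin (Or.inl (Or.inl ⟨a, rfl⟩))

theorem mulRight_mem_opAlg (a : A) : LinearMap.mulRight K a ∈ opAlg b deg :=
  Algebra.subset_adjoin (Or.inl (Or.inr ⟨a, rfl⟩))

theorem gproj_mem_opAlg (g : G) : gproj b deg g ∈ opAlg b deg :=
  Algebra.subset_adjoin (Or.inr ⟨g, rfl⟩)

theorem IsGradedIdeal.opAlg_apply_mem {P : Submodule K A} (hP : IsGradedIdeal b deg P)
    {φ : Module.End K A} (hφ : φ ∈ opAlg b deg) {x : A} (hx : x ∈ P) : φ x ∈ P := by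
  induction hφ using Algebra.adjoin_induction generalizing x with
  | mem φ hφ =>
    rcases hφ with (⟨a, rfl⟩ | ⟨a, rfl⟩) | ⟨g, rfl⟩
    · exact hP.mul_mem_left a hx
    · exact hP.mul_mem_right a hx
    · exact hP.gproj_mem g hx
  | algebraMap c => exact P.smul_mem c hx
  | add φ ψ _ _ h1 h2 => exact P.add_mem (h1 hx) (h2 hx)
  | mul φ ψ _ _ h1 h2 => exact h1 (h2 hx)

/-- A graded ideal as a submodule over `opAlg`. -/
def IsGradedIdeal.toOpAlg {P : Submodule K A} (hP : IsGradedIdeal b deg P) :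
    Submodule (opAlg b deg) A where
  carrier := P
  add_mem' := P.add_mem
  zero_mem' := P.zero_mem
  smul_mem' φ _ hx := hP.opAlg_apply_mem φ.2 hx

theorem isGradedIdeal_restrictScalars (N : Submodule (opAlg b deg) A) :
    IsGradedIdeal b deg (N.restrictScalars K) where
  mul_mem_left a _ hx := N.smul_mem (⟨_, mulLeft_mem_opAlg a⟩ : opAlg b deg) hx
  mul_mem_right a _ hx := N.smul_mem (⟨_, mulRight_mem_opAlg a⟩ : opAlg b deg) hx
  gproj_mem g _ hx := N.smul_mem (⟨_, gproj_mem_opAlg g⟩ : opAlg b deg) hx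

variable (b deg) in
/-- Maximal graded ideals. -/
structure IsMaximalGraded (P : Submodule K A) : Prop where
  isGradedIdeal : IsGradedIdeal b deg P
  ne_top : P ≠ ⊤
  eq_top {Q : Submodule K A} (hQ : IsGradedIdeal b deg Q) (h : P < Q) : Q = ⊤

theorem IsMaximalGraded.isCoatom {P : Submodule K A} (hP : IsMaximalGraded b deg P) :
    IsCoatom hP.isGradedIdeal.toOpAlg := by
  constructor
  · intro h
    refine hP.ne_top (eq_top_iff.mpr fun x _ => ?_)
    have : x ∈ hP.isGradedIdeal.toOpAlg := by rw [h]; trivial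
    exact this
  · intro N hN
    have h1 := hP.eq_top (isGradedIdeal_restrictScalars N) (by
      rw [SetLike.lt_iff_le_and_exists] at hN ⊢
      exact hN)
    refine eq_top_iff.mpr fun x _ => ?_
    have : x ∈ N.restrictScalars K := by rw [h1]; trivial
    exact this

theorem IsMaximalGraded.exists_opAlg [IsAlgClosed K] {P : Submodule K A}
    (hP : IsMaximalGraded b deg P) (β : A →ₗ[K] K) (hβ : ∀ x ∈ P, β x = 0) :
    ∃ φ ∈ opAlg b deg, ∀ x, φ x - β x • (1 : A) ∈ P := by
  have : Module.Finite K A := Module.Finite.of_basis b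
  obtain ⟨φ, hφ⟩ := exists_smul_sub_mem_of_isCoatom (R := opAlg b deg)
    (P := hP.isGradedIdeal.toOpAlg) hP.isCoatom β hβ 1
  exact ⟨φ, φ.2, hφ⟩

end Density

section Radical

variable {K A G I : Type*} [Field K] [Ring A] [Algebra K A] [Group G] [DecidableEq G]
  [Fintype I] {b : Module.Basis I K A} {deg : I → G}

theorem IsGradedIdeal.exists_le_isMaximalGraded {Q : Submodule K A} (hQ : IsGradedIdeal b deg Q)
    (hne : Q ≠ ⊤) : ∃ P, IsMaximalGraded b deg P ∧ Q ≤ P := by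
  have : Module.Finite K A := Module.Finite.of_basis b
  obtain ⟨P, ⟨h1, h2, h3⟩, h4⟩ := WellFounded.has_min
    (wellFounded_gt (α := Submodule K A))
    {P | IsGradedIdeal b deg P ∧ P ≠ ⊤ ∧ Q ≤ P} ⟨Q, hQ, hne, le_rfl⟩
  exact ⟨P, ⟨h1, h2, fun {R} hR hlt => by_contra fun hR' =>
    h4 R ⟨hR, hR', h3.trans hlt.le⟩ hlt⟩, h3⟩

theorem perp_top_le [CharZero K] (hb : IsGradedBasis b deg) {P Q : Submodule K A}
    (hP : IsGradedIdeal b deg P) (hQ : IsMaximalGraded b deg Q) (hPQ : P ≤ Q) :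
    perp hP ⊤ ≤ Q := by
  by_contra hle
  have hg := isGradedIdeal_perp hb hP isGradedIdeal_top
  have htop := hQ.eq_top (hQ.isGradedIdeal.sup hg)
    (lt_of_le_of_ne le_sup_left fun h => hle (by rw [h]; exact le_sup_right))
  obtain ⟨p, hp, u, hu, hpu⟩ := Submodule.mem_sup.mp (htop ▸ Submodule.mem_top (x := (1 : A)))
  obtain ⟨k, hk⟩ := exists_pow_mem_of_mem_perp hP isGradedIdeal_top (u := u) trivial hu
  have h1 : ∀ n, 1 - u ^ n ∈ Q := by
    intro n
    induction n with
    | zero => simp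
    | succ n ih =>
      have : 1 - u ^ (n + 1) = (1 - u ^ n) + u ^ n * p := by
        rw [eq_sub_of_add_eq hpu, pow_succ, mul_sub, mul_one]; abel
      rw [this]
      exact Q.add_mem ih (hQ.isGradedIdeal.mul_mem_left _ hp)
  refine hQ.ne_top (eq_top_iff.mpr fun x _ => ?_)
  have h2 : (1 : A) ∈ Q := by
    have := Q.add_mem (h1 k) (hPQ hk)
    rwa [sub_add_cancel] at this
  simpa using hQ.isGradedIdeal.mul_mem_left x h2

/-- The trace form of the quotient by an intersection of maximal graded ideals is nondegenerate. -/
theorem perp_top_iInf_le [CharZero K] (hb : IsGradedBasis b deg) {ι : Type*}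
    {P : ι → Submodule K A} (hP : ∀ i, IsMaximalGraded b deg (P i)) :
    perp (IsGradedIdeal.iInf fun i => (hP i).isGradedIdeal) ⊤ ≤ ⨅ i, P i :=
  le_iInf fun i => perp_top_le hb _ (hP i) (iInf_le _ i)

theorem isNilpotent_of_mem_forall_isMaximalGraded [CharZero K] (hb : IsGradedBasis b deg)
    {J : Submodule K A} (hJ : IsGradedIdeal b deg J)
    (h : ∀ Q, IsMaximalGraded b deg Q → J ≤ Q) {x : A} (hx : x ∈ J) : IsNilpotent x := by
  have : Module.Finite K A := Module.Finite.of_basis b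
  have hbot : IsGradedIdeal b deg (⊥ : Submodule K A) := isGradedIdeal_bot
  let B : LinearMap.BilinForm K A := LinearMap.mk₂ K (fun u v => quotTrace hbot (u * v))
    (fun u u' v => by rw [add_mul, map_add]) (fun c u v => by rw [smul_mul_assoc, map_smul])
    (fun u v v' => by rw [mul_add, map_add]) (fun c u v => by rw [mul_smul_comm, map_smul])
  have hB : ∀ u v, B u v = quotTrace hbot (u * v) := fun u v => rfl
  have horth : ∀ W : Submodule K A, B.orthogonal W = perp hbot W := by
    intro W
    ext u
    simp only [LinearMap.BilinForm.mem_orthogonal_iff, hB]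
    exact forall₂_congr fun v hv => by rw [quotTrace_mul_comm]
  have hrefl : B.IsRefl := fun u v huv => by
    rw [hB] at huv ⊢
    rw [quotTrace_mul_comm, huv]
  have hgJ := isGradedIdeal_perp hb hbot hJ
  have hnil : J ⊓ perp hbot J ≤ perp hbot ⊤ := fun u hu => mem_perp_of_nil hbot fun v _ => by
    obtain ⟨k, hk⟩ := exists_pow_mem_of_mem_perp hbot hJ (hJ.mul_mem_right v hu.1)
      (hgJ.mul_mem_right v hu.2)
    exact ⟨k, by simpa using hk⟩
  have hdim := LinearMap.BilinForm.finrank_add_finrank_orthogonal hrefl J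
  rw [horth, horth] at hdim
  have hle : Module.finrank K (J ⊓ perp hbot J : Submodule K A) ≤
      Module.finrank K (J ⊓ perp hbot ⊤ : Submodule K A) :=
    Submodule.finrank_mono (le_inf inf_le_left hnil)
  have hsup : J ⊔ perp hbot J = ⊤ := by
    refine Submodule.eq_top_of_finrank_eq (le_antisymm (Submodule.finrank_le _) ?_)
    have := Submodule.finrank_sup_add_finrank_inf_eq J (perp hbot J)
    omega
  have htop : perp hbot J = ⊤ := by
    by_contra hne
    obtain ⟨Q, hQ, hle⟩ := hgJ.exists_le_isMaximalGraded hne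
    exact hQ.ne_top (eq_top_iff.mpr (hsup ▸ sup_le (h Q hQ) hle))
  obtain ⟨k, hk⟩ := exists_pow_mem_of_mem_perp hbot hJ hx (htop ▸ trivial)
  exact ⟨k, by simpa using hk⟩

/-- Powers of an ideal, with the whole algebra as the power of exponent zero. -/
def idealPow (J : Submodule K A) : ℕ → Submodule K A
  | 0 => ⊤
  | n + 1 => J * idealPow J n

theorem exists_idealPow_eq_bot {J : Submodule K A} (hJ : IsGradedIdeal b deg J)
    (h : ∀ x ∈ J, IsNilpotent x) : ∃ N, idealPow J N = ⊥ := by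
  have : Module.Finite K A := Module.Finite.of_basis b
  have hart : IsArtinianRing A := isArtinian_of_tower K inferInstance
  obtain ⟨N, hN⟩ := IsArtinianRing.isNilpotent_jacobson_bot (R := A)
  refine ⟨N, ?_⟩
  have hmem : ∀ x ∈ J, x ∈ Ideal.jacobson (⊥ : Ideal A) := by
    intro x hx
    rw [Ideal.mem_jacobson_iff]
    intro y
    obtain ⟨u, hu⟩ := (h _ (hJ.mul_mem_left y hx)).isUnit_one_add
    refine ⟨↑u⁻¹, ?_⟩
    have : (↑u⁻¹ : A) * y * x + ↑u⁻¹ - 1 = ↑u⁻¹ * u - 1 := by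
      rw [hu]; noncomm_ring
    rw [this, Units.inv_mul, sub_self]
    exact Submodule.zero_mem _
  have key : ∀ n, ∀ x ∈ idealPow J n, x ∈ (Ideal.jacobson (⊥ : Ideal A)) ^ n := by
    intro n
    induction n with
    | zero => intro x _; simp [Submodule.pow_zero]
    | succ n ih =>
      intro x hx
      rw [Ideal.IsTwoSided.pow_succ]
      refine Submodule.mul_induction_on hx (fun y hy z hz => ?_) fun y z hy hz =>
        Submodule.add_mem _ hy hz
      exact Submodule.smul_mem_smul (hmem y hy) (ih z hz)
  refine eq_bot_iff.mpr fun x hx => ?_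
  have := key N x hx
  rw [hN] at this
  exact this

end Radical

end GradedCodim

namespace GradedCodim

set_option linter.unusedSectionVars false

section Decomposition

variable {K A G I : Type*} [Field K] [Ring A] [Algebra K A] [Group G] [DecidableEq G]
  [Fintype I] (b : Module.Basis I K A) (deg : I → G)

/-- A finite family of maximal graded ideals with nilpotent intersection, together with
homogeneous complete orthogonal idempotents separating them. -/
structure Decomposition where
  r : ℕ
  P : Fin r → Submodule K A
  e : Fin r → A
  isMaximalGraded : ∀ i, IsMaximalGraded b deg (P i)
  N : ℕ
  idealPow_eq_bot : idealPow (⨅ i, P i) N = ⊥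
  gproj_e : ∀ i, gproj b deg 1 (e i) = e i
  idem : CompleteOrthogonalIdempotents e
  e_mem : ∀ i j, i ≠ j → e i ∈ P j

variable {b deg}

theorem exists_finset_inf_le : ∃ s : Finset (Submodule K A), (∀ P ∈ s, IsMaximalGraded b deg P) ∧
    ∀ Q, IsMaximalGraded b deg Q → s.inf id ≤ Q := by
  classical
  have : Module.Finite K A := Module.Finite.of_basis b
  obtain ⟨M, ⟨s, hs, rfl⟩, h4⟩ := WellFounded.has_min
    (wellFounded_lt (α := Submodule K A))
    {M | ∃ s : Finset (Submodule K A), (∀ P ∈ s, IsMaximalGraded b deg P) ∧ s.inf id = M}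
    ⟨⊤, ∅, by simp, by simp⟩
  refine ⟨s, hs, fun Q hQ => ?_⟩
  have h5 := h4 ((insert Q s).inf id) ⟨insert Q s, by simpa using ⟨hQ, hs⟩, rfl⟩
  rw [Finset.inf_insert, id, inf_lt_right, not_not] at h5
  exact h5

theorem IsMaximalGraded.exists_one_sub_mem {Q : Submodule K A} (hQ : IsMaximalGraded b deg Q)
    (s : Finset (Submodule K A)) (hs : ∀ P ∈ s, IsMaximalGraded b deg P) (hQs : Q ∉ s) :
    ∃ a, (∀ P ∈ s, a ∈ P) ∧ 1 - a ∈ Q := by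
  classical
  induction s using Finset.induction with
  | empty => exact ⟨1, by simp, by simp⟩
  | insert P s hP ih =>
    obtain ⟨a, ha, ha'⟩ := ih (fun P h => hs P (Finset.mem_insert_of_mem h))
      (fun h => hQs (Finset.mem_insert_of_mem h))
    have hPm := hs P (Finset.mem_insert_self P s)
    have hsup : P ⊔ Q = ⊤ := by
      refine hPm.eq_top (hPm.isGradedIdeal.sup hQ.isGradedIdeal)
        (lt_of_le_of_ne le_sup_left fun h => ?_)
      have hle : Q ≤ P := by rw [h]; exact le_sup_right
      rcases hle.eq_or_lt with h1 | h1
      · exact hQs (h1 ▸ Finset.mem_insert_self P s)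
      · exact hPm.ne_top (hQ.eq_top hPm.isGradedIdeal h1)
    obtain ⟨p, hp, q, hq, hpq⟩ := Submodule.mem_sup.mp (hsup ▸ Submodule.mem_top (x := (1 : A)))
    refine ⟨a * p, ?_, ?_⟩
    · intro R hR
      rcases Finset.mem_insert.mp hR with rfl | hR
      · exact hPm.isGradedIdeal.mul_mem_left a hp
      · exact (hs R (Finset.mem_insert_of_mem hR)).isGradedIdeal.mul_mem_right p (ha R hR)
    · have : 1 - a * p = (1 - a) + a * q := by
        rw [eq_sub_of_add_eq hpq, mul_sub, mul_one]; abel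
      rw [this]
      exact Q.add_mem ha' (hQ.isGradedIdeal.mul_mem_left a hq)

theorem nonempty_decomposition [CharZero K] (hb : IsGradedBasis b deg) :
    Nonempty (Decomposition b deg) := by
  classical
  obtain ⟨s, hs, hs'⟩ := exists_finset_inf_le (b := b) (deg := deg)
  let P : Fin s.card → Submodule K A := fun i => (s.equivFin.symm i).1
  have hP : ∀ i, IsMaximalGraded b deg (P i) := fun i => hs _ (s.equivFin.symm i).2
  have hinj : Function.Injective P := Subtype.val_injective.comp s.equivFin.symm.injective
  let J := ⨅ i, P i
  have hJle : ∀ i, J ≤ P i := iInf_le P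
  have hJ : IsGradedIdeal b deg J := IsGradedIdeal.iInf fun i => (hP i).isGradedIdeal
  have hJQ : ∀ Q, IsMaximalGraded b deg Q → J ≤ Q := by
    intro Q hQ
    refine le_trans (Finset.le_inf fun R hR => ?_) (hs' Q hQ)
    have := hJle (s.equivFin ⟨R, hR⟩)
    simpa [P] using this
  have hnil : ∀ x ∈ J, IsNilpotent x := fun x hx =>
    isNilpotent_of_mem_forall_isMaximalGraded hb hJ hJQ hx
  obtain ⟨N, hN⟩ := exists_idealPow_eq_bot hJ hnil
  have hu : ∀ i, ∃ u, gproj b deg 1 u = u ∧ (∀ j, i ≠ j → u ∈ P j) ∧ 1 - u ∈ P i := by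
    intro i
    obtain ⟨a, ha, ha'⟩ := (hP i).exists_one_sub_mem ((Finset.univ.erase i).image P)
      (by simp only [Finset.mem_image]; rintro _ ⟨j, _, rfl⟩; exact hP j)
      (by simpa using fun j hj h => hj (hinj h))
    refine ⟨gproj b deg 1 a, by rw [gproj_gproj, if_pos rfl], fun j hj => ?_, ?_⟩
    · exact (hP j).isGradedIdeal.gproj_mem 1
        (ha _ (Finset.mem_image_of_mem P (by simpa using hj.symm)))
    · have := (hP i).isGradedIdeal.gproj_mem 1 ha'
      rwa [map_sub, hb.gproj_one, if_pos rfl] at this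
  choose u hu1 hu2 hu3 using hu
  let A₁ : Subring A :=
    { carrier := {x | gproj b deg 1 x = x}
      mul_mem' := fun {x y} hx hy => by
        have hx' : gproj b deg 1 x = x := hx
        have hy' : gproj b deg 1 y = y := hy
        have := hb.gproj_gproj_mul 1 1 x y
        rwa [hx', inv_one, mul_one, hy'] at this
      one_mem' := by
        have := hb.gproj_one 1
        rwa [if_pos rfl] at this
      add_mem' := fun {x y} hx hy => by
        have hx' : gproj b deg 1 x = x := hx
        have hy' : gproj b deg 1 y = y := hy
        change gproj b deg 1 (x + y) = x + y
        rw [map_add, hx', hy']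
      zero_mem' := map_zero _
      neg_mem' := fun {x} hx => by
        have hx' : gproj b deg 1 x = x := hx
        change gproj b deg 1 (-x) = -x
        rw [map_neg, hx'] }
  let f : A₁ →+* Module.End K (A ⧸ J) := ((quotLeft hJ : A →ₐ[K] _) : A →+* _).comp A₁.subtype
  have hf : ∀ x : A₁, f x = quotLeft hJ (x : A) := fun x => rfl
  have hker : ∀ x ∈ RingHom.ker f, IsNilpotent x := by
    intro x hx
    rw [RingHom.mem_ker, hf, quotLeft_eq_zero_iff] at hx
    obtain ⟨k, hk⟩ := hnil _ hx
    exact ⟨k, Subtype.ext (by simpa using hk)⟩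
  have hE : CompleteOrthogonalIdempotents fun i => f ⟨u i, hu1 i⟩ := by
    rw [CompleteOrthogonalIdempotents.iff_ortho_complete]
    constructor
    · intro i j hij
      rw [hf, hf, ← map_mul, quotLeft_eq_zero_iff, Submodule.mem_iInf]
      intro k
      by_cases hk : i = k
      · exact (hP k).isGradedIdeal.mul_mem_left _ (hu2 j k (hk ▸ hij.symm))
      · exact (hP k).isGradedIdeal.mul_mem_right _ (hu2 i k hk)
    · rw [← sub_eq_zero]
      simp only [hf]
      rw [← map_sum, ← map_one (quotLeft hJ), ← map_sub, quotLeft_eq_zero_iff, Submodule.mem_iInf]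
      intro k
      rw [← Finset.add_sum_erase _ _ (Finset.mem_univ k), ← neg_mem_iff, neg_sub, ← sub_sub]
      exact (P k).sub_mem (hu3 k)
        ((P k).sum_mem fun i hi => hu2 i k (Finset.ne_of_mem_erase hi))
  obtain ⟨e, he, he'⟩ :=
    CompleteOrthogonalIdempotents.lift_of_isNilpotent_ker f hker hE fun i => ⟨_, rfl⟩
  have hsub : ∀ i, (e i : A) - u i ∈ J := by
    intro i
    rw [← quotLeft_eq_zero_iff hJ, map_sub, sub_eq_zero]
    exact congrFun he' i
  exact ⟨⟨s.card, P, fun i => e i, hP, N, hN, fun i => (e i).2, he.map A₁.subtype, fun i j hij => by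
    have := (P j).add_mem (hJle j (hsub i)) (hu2 i j hij)
    rwa [sub_add_cancel] at this⟩⟩

namespace Decomposition

variable (D : Decomposition b deg)

/-- The intersection of the maximal ideals of the decomposition. -/
def J : Submodule K A := ⨅ i, D.P i

theorem mem_J {x : A} : x ∈ D.J ↔ ∀ i, x ∈ D.P i := Submodule.mem_iInf _

theorem isGradedIdeal_J : IsGradedIdeal b deg D.J :=
  IsGradedIdeal.iInf fun i => (D.isMaximalGraded i).isGradedIdeal

theorem one_sub_e_mem (i) : 1 - D.e i ∈ D.P i := by
  classical
  rw [← D.idem.complete, ← Finset.add_sum_erase _ _ (Finset.mem_univ i), add_sub_cancel_left]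
  exact (D.P i).sum_mem fun j hj => D.e_mem j i (Finset.ne_of_mem_erase hj)

theorem e_mul_mul_e_mem_J {i j} (hij : i ≠ j) (x : A) : D.e i * x * D.e j ∈ D.J := by
  rw [mem_J]
  intro k
  by_cases hk : i = k
  · exact (D.isMaximalGraded k).isGradedIdeal.mul_mem_left _ (D.e_mem j k (hk ▸ hij.symm))
  · rw [mul_assoc]
    exact (D.isMaximalGraded k).isGradedIdeal.mul_mem_right _ (D.e_mem i k hk)

theorem e_mul_mul_e_mem_J_of_mem {i} {x : A} (hx : x ∈ D.P i) : D.e i * x * D.e i ∈ D.J := by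
  rw [mem_J]
  intro k
  by_cases hk : i = k
  · subst hk
    exact (D.isMaximalGraded i).isGradedIdeal.mul_mem_right _
      ((D.isMaximalGraded i).isGradedIdeal.mul_mem_left _ hx)
  · exact (D.isMaximalGraded k).isGradedIdeal.mul_mem_left _ (D.e_mem i k hk)

theorem gproj_e_mul (hb : IsGradedBasis b deg) (g : G) (x : A) (i) :
    gproj b deg g (D.e i * x) = D.e i * gproj b deg g x := by
  have := hb.gproj_gproj_mul g 1 (D.e i) x
  rwa [D.gproj_e, inv_one, one_mul] at this

/-- The idempotent attached to an optional index, with `none` giving `1`. -/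
def E : Option (Fin D.r) → A
  | none => 1
  | some i => D.e i

/-- The intersection of the maximal ideals with index in `S`. -/
def PS (S : Finset (Fin D.r)) : Submodule K A := ⨅ i : S, D.P i

theorem mem_PS {S : Finset (Fin D.r)} {x : A} : x ∈ D.PS S ↔ ∀ i ∈ S, x ∈ D.P i := by
  simp [PS, Submodule.mem_iInf]

theorem isGradedIdeal_PS (S : Finset (Fin D.r)) : IsGradedIdeal b deg (D.PS S) :=
  IsGradedIdeal.iInf fun i : S => (D.isMaximalGraded i).isGradedIdeal

theorem perp_PS_le [CharZero K] (hb : IsGradedBasis b deg) (S : Finset (Fin D.r)) :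
    perp (D.isGradedIdeal_PS S) ⊤ ≤ D.PS S :=
  perp_top_iInf_le hb fun i : S => D.isMaximalGraded i

/-- A set of indices is good if it is covered by the indices visited by a nonzero product. -/
def Good (S : Finset (Fin D.r)) : Prop :=
  ∃ l : List (Option (Fin D.r) × A), (l.map fun p => D.E p.1 * p.2).prod ≠ 0 ∧
    ∀ i ∈ S, ∃ p ∈ l, p.1 = some i

end Decomposition

end Decomposition

end GradedCodim

namespace GradedCodim

set_option linter.unusedSectionVars false

section UpperBound

universe u

variable {K G I : Type*} {A : Type u} [Field K] [Ring A] [Algebra K A] [Group G] [DecidableEq G]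
  [Fintype I] {b : Module.Basis I K A} {deg : I → G}

theorem mul_mem_idealPow {J : Submodule K A} (hJ : IsGradedIdeal b deg J) (a : A) {n : ℕ} {x : A}
    (hx : x ∈ idealPow J n) : a * x ∈ idealPow J n := by
  cases n with
  | zero => trivial
  | succ n =>
    refine Submodule.mul_induction_on hx (fun y hy z hz => ?_) fun y z hy hz => ?_
    · rw [← mul_assoc]
      exact Submodule.mul_mem_mul (hJ.mul_mem_left a hy) hz
    · rw [mul_add]
      exact Submodule.add_mem _ hy hz

theorem idealPow_antitone {J : Submodule K A} (hJ : IsGradedIdeal b deg J) :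
    Antitone (idealPow J) := by
  refine antitone_nat_of_succ_le fun n => ?_
  exact Submodule.mul_le.mpr fun y _ z hz => mul_mem_idealPow hJ y hz

theorem list_prod_mem_idealPow {J : Submodule K A} (hJ : IsGradedIdeal b deg J) {α : Type*}
    (f : α → A) (q : α → Bool) (l : List α) (h : ∀ a ∈ l, q a → f a ∈ J) :
    (l.map f).prod ∈ idealPow J (l.countP q) := by
  induction l with
  | nil => trivial
  | cons a l ih =>
    have ih := ih fun a' ha' => h a' (List.mem_cons_of_mem _ ha')
    rw [List.map_cons, List.prod_cons, List.countP_cons]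
    by_cases hq : q a
    · rw [if_pos hq]
      exact Submodule.mul_mem_mul (h a List.mem_cons_self hq) ih
    · rw [if_neg hq]
      exact mul_mem_idealPow hJ _ ih

theorem exists_subset_range {α : Type*} [Fintype α] [Nonempty α] {N : ℕ} (T : Finset α)
    (hT : T.card ≤ N) : ∃ u : Fin N → α, ∀ t ∈ T, ∃ j, u j = t := by
  let g : T → Fin N := fun t => Fin.castLE hT (T.equivFin t)
  have hg : Function.Injective g := (Fin.castLE_injective hT).comp T.equivFin.injective
  classical
  refine ⟨fun j => if h : ∃ t, g t = j then (h.choose : α) else Classical.arbitrary α,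
    fun t ht => ⟨g ⟨t, ht⟩, ?_⟩⟩
  have h : ∃ t', g t' = g ⟨t, ht⟩ := ⟨_, rfl⟩
  beta_reduce
  rw [dif_pos h, hg h.choose_spec]

/-- Counting maps with few values outside of small sets. -/
theorem card_le_of_forall_exists {α Z σ : Type*} [Fintype α] [Nonempty α] [Fintype Z] [Fintype σ]
    (W : σ → Finset Z) {d N : ℕ} (hW : ∀ s, (W s).card ≤ d) (hN : N < Fintype.card α)
    (P : Set (α → Z))
    (hP : ∀ p ∈ P, ∃ s, ∃ T : Finset α, T.card ≤ N ∧ ∀ k ∉ T, p k ∈ W s) :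
    Nat.card P ≤ Fintype.card σ * (Fintype.card α ^ N * ((Fintype.card Z + 1) ^ N * d ^ Fintype.card α)) := by
  classical
  let R : σ → (Fin N → α) → Finset (α → Z) := fun s u =>
    Fintype.piFinset fun k => if ∃ j, u j = k then Finset.univ else W s
  have hR : ∀ s u, (R s u).card ≤ (Fintype.card Z + 1) ^ N * d ^ Fintype.card α := by
    intro s u
    let T : Finset α := Finset.univ.filter fun k => ∃ j, u j = k
    have hT : T.card ≤ N := by
      have : T ⊆ Finset.univ.image u := by
        intro k hk
        simpa [T] using hk
      refine (Finset.card_le_card this).trans (Finset.card_image_le.trans (by simp))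
    have hc : (R s u).card =
        Fintype.card Z ^ T.card * (W s).card ^ (Fintype.card α - T.card) := by
      have hT' : (Finset.univ.filter fun k => ¬∃ j, u j = k).card = Fintype.card α - T.card := by
        have := Finset.card_filter_add_card_filter_not (s := (Finset.univ : Finset α))
          (fun k => ∃ j, u j = k)
        rw [Finset.card_univ] at this
        change T.card + _ = _ at this
        omega
      rw [Fintype.card_piFinset]
      have : ∀ k, (if ∃ j, u j = k then (Finset.univ : Finset Z) else W s).card =
          if ∃ j, u j = k then Fintype.card Z else (W s).card := by
        intro k
        split_ifs <;> simp
      simp_rw [this]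
      rw [Finset.prod_ite, Finset.prod_const, Finset.prod_const, hT']
    rw [hc]
    refine Nat.mul_le_mul ?_ ?_
    · exact (Nat.pow_le_pow_left (Nat.le_succ _) _).trans (Nat.pow_le_pow_right (by omega) hT)
    · refine (Nat.pow_le_pow_left (hW s) _).trans ?_
      rcases Nat.eq_zero_or_pos d with rfl | hd
      · rw [zero_pow (by omega), zero_pow (by omega)]
      · exact Nat.pow_le_pow_right hd (Nat.sub_le _ _)
  have hsub : P ⊆ ((Finset.univ : Finset (σ × (Fin N → α))).biUnion fun su => R su.1 su.2) := by
    intro p hp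
    obtain ⟨s, T, hT, h⟩ := hP p hp
    obtain ⟨u, hu⟩ := exists_subset_range T hT
    simp only [Finset.coe_biUnion, Set.mem_iUnion]
    refine ⟨(s, u), Finset.mem_coe.mpr (Finset.mem_univ _), Finset.mem_coe.mpr ?_⟩
    rw [Fintype.mem_piFinset]
    intro k
    split_ifs with h1
    · exact Finset.mem_univ _
    · exact h k fun hk => h1 (hu k hk)
  have h1 : Nat.card P ≤ ((Finset.univ : Finset (σ × (Fin N → α))).biUnion
      fun su => R su.1 su.2).card := by
    have := Set.ncard_le_ncard hsub (Finset.finite_toSet _)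
    rwa [Set.ncard_coe_finset] at this
  refine h1.trans (Finset.card_biUnion_le.trans ?_)
  refine (Finset.sum_le_card_nsmul _ _ _ fun su _ => hR su.1 su.2).trans ?_
  rw [Finset.card_univ, Fintype.card_prod, Fintype.card_fun, Fintype.card_fin, smul_eq_mul,
    mul_assoc]

namespace Decomposition

variable (D : Decomposition b deg)

theorem exists_spanning : ∃ (Z : Type u) (_ : Fintype Z) (z : Z → A) (cls : Z → Option (Fin D.r)),
    Submodule.span K (Set.range z) = ⊤ ∧ (∀ k, cls k = none → z k ∈ D.J) ∧
    (∀ k i, cls k = some i → D.e i * z k = z k) ∧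
    ∀ S : Finset (Fin D.r), (Finset.univ.filter fun k => ∃ i ∈ S, cls k = some i).card ≤
      Module.finrank K (A ⧸ D.PS S) := by
  classical
  have : Module.Finite K A := Module.Finite.of_basis b
  let U : Set (A ⧸ D.J) := {v | ∃ i y, D.e i * y * D.e i = y ∧ D.J.mkQ y = v}
  obtain ⟨B, hBU, hBspan, hBli⟩ := exists_linearIndependent K U
  have hU : ∀ v : B, ∃ i y, D.e i * y * D.e i = y ∧ D.J.mkQ y = v := fun v => hBU v.2
  choose i y hy hyv using hU
  have : Finite B := hBli.finite
  let _ : Fintype B := Fintype.ofFinite B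
  let bJ := Module.finBasis K D.J
  have hidem : ∀ j, D.e j * D.e j = D.e j := fun j => D.idem.idem j
  have hspanJ : D.J ≤ Submodule.span K (Set.range (Sum.elim (fun k => (bJ k : A)) y)) := by
    intro x hx
    have h1 := congrArg Subtype.val (bJ.sum_repr ⟨x, hx⟩)
    rw [← show _ = x from h1]
    simp only [AddSubmonoidClass.coe_finsetSum, SetLike.val_smul]
    exact Submodule.sum_mem _ fun k _ => Submodule.smul_mem _ _
      (Submodule.subset_span ⟨Sum.inl k, rfl⟩)
  have hspan2 : ∀ x j, D.e j * x * D.e j ∈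
      Submodule.span K (Set.range (Sum.elim (fun k => (bJ k : A)) y)) := by
    intro x j
    have h1 : D.J.mkQ (D.e j * x * D.e j) ∈ Submodule.span K B := by
      rw [hBspan]
      refine Submodule.subset_span ⟨j, _, ?_, rfl⟩
      calc _ = (D.e j * D.e j) * x * (D.e j * D.e j) := by simp only [mul_assoc]
        _ = _ := by rw [hidem]
    have h2 : B = D.J.mkQ '' Set.range y := by
      ext v
      constructor
      · intro hv
        exact ⟨_, ⟨⟨v, hv⟩, rfl⟩, hyv _⟩
      · rintro ⟨_, ⟨v, rfl⟩, rfl⟩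
        rw [hyv]
        exact v.2
    rw [h2, ← Submodule.map_span] at h1
    obtain ⟨w, hw, hwx⟩ := h1
    have h3 : D.e j * x * D.e j - w ∈ D.J := by
      rw [← Submodule.ker_mkQ D.J, LinearMap.mem_ker, map_sub, hwx, sub_self]
    have := Submodule.add_mem _ (hspanJ h3)
      (Submodule.span_mono (by rintro _ ⟨v, rfl⟩; exact ⟨Sum.inr v, rfl⟩) hw)
    rwa [sub_add_cancel] at this
  refine ⟨Fin (Module.finrank K D.J) ⊕ B, inferInstance, Sum.elim (fun k => (bJ k : A)) y,
    Sum.elim (fun _ => none) fun v => some (i v), ?_, ?_, ?_, ?_⟩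
  · refine eq_top_iff.mpr fun x _ => ?_
    have hx : x = ∑ j, ∑ k, D.e j * x * D.e k := by
      simp_rw [← Finset.mul_sum, D.idem.complete, mul_one, ← Finset.sum_mul, D.idem.complete,
        one_mul]
    rw [hx]
    refine Submodule.sum_mem _ fun j _ => Submodule.sum_mem _ fun k _ => ?_
    by_cases hjk : j = k
    · subst hjk
      exact hspan2 x j
    · exact hspanJ (D.e_mul_mul_e_mem_J hjk x)
  · rintro (k | v) hk
    · exact (bJ k).2
    · simp at hk
  · rintro (k | v) j hk
    · simp at hk
    · simp only [Sum.elim_inr, Option.some.injEq] at hk ⊢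
      subst hk
      conv_lhs => rw [← hy v]
      rw [← mul_assoc, ← mul_assoc, hidem, hy]
  · intro S
    let BS : Finset B := Finset.univ.filter fun v => i v ∈ S
    have hcard : (Finset.univ.filter fun k : Fin (Module.finrank K D.J) ⊕ B =>
        ∃ j ∈ S, Sum.elim (fun _ => none) (fun v => some (i v)) k = some j).card ≤ BS.card := by
      refine (Finset.card_le_card (t := BS.map ⟨Sum.inr, Sum.inr_injective⟩) ?_).trans
        (Finset.card_map _).le
      rintro (k | v) hk
      · simp at hk
      · simpa [BS] using hk
    refine hcard.trans ?_
    have hli : LinearIndependent K fun v : BS => (D.PS S).mkQ (y v) := by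
      rw [Fintype.linearIndependent_iff]
      intro c hc
      have h1 : ∑ v, c v • y v ∈ D.PS S := by
        rw [← Submodule.ker_mkQ (D.PS S), LinearMap.mem_ker, map_sum]
        simpa only [map_smul] using hc
      have h2 : ∑ v, c v • y v ∈ D.J := by
        rw [mem_J]
        intro j
        by_cases hj : j ∈ S
        · exact D.mem_PS.mp h1 j hj
        · refine Submodule.sum_mem _ fun v _ => Submodule.smul_mem _ _ ?_
          rw [← hy v]
          refine (D.isMaximalGraded j).isGradedIdeal.mul_mem_left _ (D.e_mem _ _ ?_)
          rintro rfl
          exact hj (Finset.mem_filter.mp v.2).2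
      have h3 : LinearIndependent K fun v : BS => ((v : B) : A ⧸ D.J) :=
        hBli.comp _ Subtype.val_injective
      rw [Fintype.linearIndependent_iff] at h3
      refine h3 c ?_
      have h4 : D.J.mkQ (∑ v, c v • y v) = 0 := by
        rwa [← LinearMap.mem_ker, Submodule.ker_mkQ]
      rw [map_sum] at h4
      simpa only [map_smul, hyv] using h4
    simpa using hli.fintype_card_le_finrank

theorem finrank_multi_upper (hb : IsGradedBasis b deg) {d : ℕ}
    (hd : ∀ S, D.Good S → Module.finrank K (A ⧸ D.PS S) ≤ d) :
    ∃ C E : ℕ, ∀ᶠ n in Filter.atTop,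
      Module.finrank K (multi b deg (Finset.range n) 0) ≤ C * n ^ E * d ^ n := by
  classical
  obtain ⟨Z, _, z, cls, hz, hnone, hsome, hS⟩ := D.exists_spanning
  refine ⟨Fintype.card {S // D.Good S} * (Fintype.card Z + 1) ^ D.N * Module.finrank K A, D.N,
    Filter.eventually_atTop.mpr ⟨D.N + 1, fun n hn => ?_⟩⟩
  have hne : Nonempty (Finset.range n) := ⟨⟨0, Finset.mem_range.mpr (by omega)⟩⟩
  let T : (Finset.range n → Z) → Finset (Finset.range n) := fun p =>
    Finset.univ.filter fun k => cls (p k) = none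
  let V : (Finset.range n → Z) → Finset (Fin D.r) := fun p =>
    Finset.univ.filter fun i => ∃ k, cls (p k) = some i
  let P : Set (Finset.range n → Z) := {p | (T p).card < D.N ∧ D.Good (V p)}
  have hcard := card_le_of_forall_exists (σ := {S // D.Good S})
    (fun S => Finset.univ.filter fun k => ∃ i ∈ S.1, cls k = some i) (d := d) (N := D.N)
    (fun S => (hS S).trans (hd S S.2)) (by simpa using hn) P (by
      intro p hp
      refine ⟨⟨V p, hp.2⟩, T p, hp.1.le, fun k hk => ?_⟩
      have hk' : cls (p k) ≠ none := by simpa [T] using hk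
      obtain ⟨i, hi⟩ := Option.ne_none_iff_exists'.mp hk'
      simp only [Finset.mem_filter, Finset.mem_univ, true_and]
      exact ⟨i, Finset.mem_filter.mpr ⟨Finset.mem_univ _, k, hi⟩, hi⟩)
  rw [Fintype.card_coe, Finset.card_range] at hcard
  refine (finrank_multi_le hz P ?_).2.trans ?_
  · intro f hf p hp x hx
    induction hf using Submodule.span_induction with
    | mem f hf =>
      obtain ⟨l, hl1, hl2, rfl⟩ := IsWord.exists_list hf
      by_contra hne
      refine hp ?_
      let cls' : ℕ → Option (Fin D.r) := fun k =>
        if h : k ∈ Finset.range n then cls (p ⟨k, h⟩) else none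
      have hcls : ∀ k : Finset.range n, cls' k = cls (p k) := fun k => dif_pos k.2
      have hmem : ∀ q ∈ l, q.1 ∈ Finset.range n := by
        intro q hq
        rw [← hl2]
        exact List.mem_toFinset.mpr (List.mem_map_of_mem hq)
      constructor
      · by_contra hlt
        have h1 := list_prod_mem_idealPow D.isGradedIdeal_J (fun q => gproj b deg q.2 (x q.1))
          (fun q => decide (cls' q.1 = none)) l (by
            intro q hq h
            refine D.isGradedIdeal_J.gproj_mem _ ?_
            rw [hx ⟨q.1, hmem q hq⟩]
            refine hnone _ ?_
            rw [← hcls]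
            simpa using h)
        have h2 : D.N ≤ l.countP fun q => decide (cls' q.1 = none) := by
          refine (not_lt.mp hlt).trans (le_of_eq ?_)
          have h3 : (l.countP fun q => decide (cls' q.1 = none)) =
              ((l.map Prod.fst).filter fun k => decide (cls' k = none)).length := by
            rw [← List.countP_eq_length_filter, List.countP_map]
            rfl
          rw [h3, ← List.toFinset_card_of_nodup (hl1.filter _), List.toFinset_filter, hl2]
          refine (Finset.card_map (Function.Embedding.subtype _)).symm.trans
            (congrArg Finset.card ?_)
          ext k
          simp only [Finset.mem_map, T, Finset.mem_filter, Finset.mem_univ, true_and,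
            Function.Embedding.subtype_apply, decide_eq_true_eq]
          constructor
          · rintro ⟨k, hk, rfl⟩
            exact ⟨k.2, by rw [hcls, hk]⟩
          · rintro ⟨hk, hk'⟩
            exact ⟨⟨k, hk⟩, by rw [← hcls]; exact hk', rfl⟩
        have h4 := idealPow_antitone D.isGradedIdeal_J h2 h1
        rw [show idealPow D.J D.N = ⊥ from D.idealPow_eq_bot] at h4
        exact hne (by simpa using h4)
      · refine ⟨l.map fun q => (cls' q.1, gproj b deg q.2 (x q.1)), ?_, ?_⟩
        · rw [List.map_map]
          refine fun h0 => hne (Eq.trans (congrArg List.prod ?_) h0)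
          refine List.map_congr_left fun q hq => ?_
          simp only [Function.comp_apply]
          rcases hc : cls' q.1 with _ | i
          · exact (one_mul _).symm
          · symm
            change D.e i * _ = _
            rw [← D.gproj_e_mul hb, hx ⟨q.1, hmem q hq⟩, hsome]
            rw [← hcls]
            exact hc
        · intro i hi
          obtain ⟨k, hk⟩ := (Finset.mem_filter.mp hi).2
          have : (k : ℕ) ∈ l.map Prod.fst := by
            rw [← List.mem_toFinset, hl2]
            exact k.2
          obtain ⟨q, hq, hqk⟩ := List.mem_map.mp this
          refine ⟨_, List.mem_map_of_mem hq, ?_⟩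
          simp only
          rw [hqk, hcls, hk]
    | zero => rfl
    | add f f' _ _ h1 h2 => rw [Pi.add_apply, h1, h2, add_zero]
    | smul c f _ h1 => rw [Pi.smul_apply, h1, smul_zero]
  · refine (Nat.mul_le_mul_right _ hcard).trans (le_of_eq ?_)
    ring

end Decomposition

end UpperBound

end GradedCodim

namespace GradedCodim

set_option linter.unusedSectionVars false

section MultiExtras

variable {K A G I : Type*} [Field K] [Ring A] [Algebra K A] [Group G] [DecidableEq G]
  [Fintype I] {b : Module.Basis I K A} {deg : I → G} {s t : Finset ℕ} {k l : ℕ}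
  {f f' : (ℕ → A) → A}

theorem IsWord.rename (hf : IsWord b deg s k f) {ρ : ℕ → ℕ} (hρ : Function.Injective ρ) :
    IsWord b deg (s.image ρ) k fun x => f fun i => x (ρ i) := by
  induction hf with
  | nil => exact IsWord.nil
  | var i g s k f hi hf ih =>
    rw [Finset.image_insert]
    exact IsWord.var (ρ i) g _ k _ (by rwa [hρ.mem_finset_image]) ih
  | const j s k f hf ih => exact IsWord.const j _ k _ ih

theorem multi_rename (hf : f ∈ multi b deg s k) {ρ : ℕ → ℕ} (hρ : Function.Injective ρ) :
    (fun x => f fun i => x (ρ i)) ∈ multi b deg (s.image ρ) k := by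
  induction hf using Submodule.span_induction with
  | mem f hf => exact Submodule.subset_span (IsWord.rename hf hρ)
  | zero => exact Submodule.zero_mem _
  | add f f' _ _ h1 h2 => exact Submodule.add_mem _ h1 h2
  | smul c f _ h1 => exact Submodule.smul_mem _ c h1

theorem multi_specialize_finset (hb : IsGradedBasis b deg) (hf : f ∈ multi b deg s k)
    (ht : t ⊆ s) (a : ℕ → A) :
    (fun x => f fun i => if i ∈ t then a i else x i) ∈ multi b deg (s \ t) (k + t.card) := by
  induction t using Finset.induction with
  | empty => simpa using hf
  | insert i t hi ih =>
    have h1 := multi_specialize hb (ih fun j hj => ht (Finset.mem_insert_of_mem hj))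
      (i := i) (by simpa [hi] using ht (Finset.mem_insert_self i t)) (a i)
    rw [Finset.card_insert_of_notMem hi, Finset.sdiff_insert, ← add_assoc]
    convert h1 using 1
    ext x
    congr 1
    ext j
    by_cases hj : j = i
    · subst hj
      simp [hi]
    · simp [hj]

theorem exists_multi_opAlg (hb : IsGradedBasis b deg) :
    ∃ k, ∀ φ ∈ opAlg b deg, ∀ j, (fun x : ℕ → A => φ (x j)) ∈ multi b deg {j} k := by
  have : Module.Finite K A := Module.Finite.of_basis b
  have key : ∀ φ ∈ opAlg b deg, ∃ k, ∀ j, (fun x : ℕ → A => φ (x j)) ∈ multi b deg {j} k := by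
    intro φ hφ
    induction hφ using Algebra.adjoin_induction with
    | mem φ hφ =>
      rcases hφ with (⟨a, rfl⟩ | ⟨a, rfl⟩) | ⟨g, rfl⟩
      · exact ⟨1, fun j => multi_mul_left (multi_var j) a⟩
      · refine ⟨1, fun j => ?_⟩
        have := multi_mul (multi_var (b := b) (deg := deg) j)
          (multi_const (b := b) (deg := deg) a) (Finset.disjoint_empty_right _)
        simpa using this
      · exact ⟨0, fun j => multi_gproj hb (multi_var j) g⟩
    | algebraMap c => exact ⟨0, fun j => Submodule.smul_mem _ c (multi_var j)⟩
    | add φ ψ _ _ h1 h2 =>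
      obtain ⟨k, hk⟩ := h1
      obtain ⟨l, hl⟩ := h2
      exact ⟨max k l, fun j => Submodule.add_mem _ (multi_mono (le_max_left k l) (hk j))
        (multi_mono (le_max_right k l) (hl j))⟩
    | mul φ ψ _ _ h1 h2 =>
      obtain ⟨k, hk⟩ := h1
      obtain ⟨l, hl⟩ := h2
      refine ⟨k + l, fun j => ?_⟩
      have := multi_subst hb (hk j) (hl j) (Finset.mem_singleton_self j) (by simp)
      simpa using this
  let M : Submodule K (A →ₗ[K] A) :=
    { carrier := {φ | φ ∈ opAlg b deg}
      add_mem' := (opAlg b deg).add_mem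
      zero_mem' := (opAlg b deg).zero_mem
      smul_mem' := fun c _ h => (opAlg b deg).smul_mem h c }
  have : Module.Free K M := Module.Free.of_divisionRing K M
  let v := Module.finBasis K M
  choose κ hκ using fun i => key (v i) (v i).2
  refine ⟨Finset.univ.sup κ, fun φ hφ j => ?_⟩
  have h1 : (fun x : ℕ → A => φ (x j)) =
      ∑ i, v.repr ⟨φ, hφ⟩ i • fun x : ℕ → A => (v i : Module.End K A) (x j) := by
    ext x
    have h2 := congrArg Subtype.val (v.sum_repr ⟨φ, hφ⟩)
    rw [AddSubmonoidClass.coe_finsetSum] at h2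
    have h3 := LinearMap.congr_fun h2 (x j)
    rw [LinearMap.sum_apply] at h3
    rw [Finset.sum_apply]
    exact h3.symm
  rw [h1]
  exact Submodule.sum_mem _ fun i _ => Submodule.smul_mem _ _
    (multi_mono (Finset.le_sup (Finset.mem_univ i)) (hκ i j))

end MultiExtras

section Witness

variable {K A G I : Type*} [Field K] [Ring A] [Algebra K A] [Group G] [DecidableEq G]
  [Fintype I] {b : Module.Basis I K A} {deg : I → G}

theorem mul_mem_idealPow_add {J : Submodule K A} (hJ : IsGradedIdeal b deg J) {n m : ℕ} {x y : A}
    (hx : x ∈ idealPow J n) (hy : y ∈ idealPow J m) : x * y ∈ idealPow J (n + m) := by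
  induction n generalizing x with
  | zero => rw [zero_add]; exact mul_mem_idealPow hJ x hy
  | succ n ih =>
    rw [add_right_comm]
    refine Submodule.mul_induction_on hx (fun u hu z hz => ?_) fun u z hu hz => ?_
    · rw [mul_assoc]
      exact Submodule.mul_mem_mul hu (ih hz)
    · rw [add_mul]
      exact Submodule.add_mem _ hu hz

theorem mul_mem_idealPow_right {J : Submodule K A} (hJ : IsGradedIdeal b deg J) {n : ℕ} {x : A}
    (hx : x ∈ idealPow J n) (a : A) : x * a ∈ idealPow J n :=
  mul_mem_idealPow_add hJ (m := 0) hx trivial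

theorem mem_idealPow_one {J : Submodule K A} {x : A} (hx : x ∈ J) : x ∈ idealPow J 1 := by
  rw [← mul_one x]
  exact Submodule.mul_mem_mul hx trivial

end Witness

end GradedCodim

namespace GradedCodim

set_option linter.unusedSectionVars false

namespace Decomposition

variable {K A G I : Type*} [Field K] [Ring A] [Algebra K A] [Group G] [DecidableEq G]
  [Fintype I] {b : Module.Basis I K A} {deg : I → G} (D : Decomposition b deg)

theorem E_mul_E (o : Option (Fin D.r)) : D.E o * D.E o = D.E o := by
  cases o with
  | none => exact one_mul 1
  | some i => exact D.idem.idem i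

/-- A multilinear product passing through the blocks with the given classes. -/
def pathProd (c : ℕ → Option (Fin D.r)) (t y : ℕ → A) (m : ℕ) (x : ℕ → A) : A :=
  ((List.range m).map fun k => D.E (c k) * t k * D.E (c k) * x k * D.E (c k) * y k).prod

theorem pathProd_succ (c : ℕ → Option (Fin D.r)) (t y : ℕ → A) (m : ℕ) (x : ℕ → A) :
    D.pathProd c t y (m + 1) x = D.pathProd c t y m x *
      (D.E (c m) * t m * D.E (c m) * x m * D.E (c m) * y m) := by
  simp [pathProd, List.range_succ]

theorem pathProd_mem_multi (c : ℕ → Option (Fin D.r)) (t y : ℕ → A) (m : ℕ) :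
    D.pathProd c t y m ∈ multi b deg (Finset.range m) (m * 2) := by
  induction m with
  | zero => exact multi_mono (Nat.zero_le _) multi_one
  | succ m ih =>
    have h1 := multi_mul (multi_mul_left (multi_var (b := b) (deg := deg) m)
      (D.E (c m) * t m * D.E (c m))) (multi_const (b := b) (deg := deg) (D.E (c m) * y m))
      (Finset.disjoint_empty_right _)
    have h2 := multi_mul ih h1 (by simp)
    rw [Finset.union_empty, Finset.union_comm, ← Finset.insert_eq, ← Finset.range_add_one] at h2
    rw [add_mul]
    convert h2 using 1
    ext x
    rw [pathProd_succ]
    simp only [mul_assoc]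

theorem pathProd_mem_idealPow (c : ℕ → Option (Fin D.r)) (t y : ℕ → A) (m : ℕ) (x : ℕ → A)
    (w : ℕ → ℕ) (h : ∀ k, t k ∈ idealPow D.J (w k)) :
    D.pathProd c t y m x ∈ idealPow D.J (∑ k ∈ Finset.range m, w k) := by
  have hJ := D.isGradedIdeal_J
  induction m with
  | zero => trivial
  | succ m ih =>
    rw [pathProd_succ, Finset.sum_range_succ]
    refine mul_mem_idealPow_add hJ ih ?_
    exact mul_mem_idealPow_right hJ (mul_mem_idealPow_right hJ (mul_mem_idealPow_right hJ
      (mul_mem_idealPow_right hJ (mul_mem_idealPow hJ _ (h m)) _) _) _) _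

theorem Good.exists_pathProd {S : Finset (Fin D.r)} (hS : D.Good S) :
    ∃ c t y m, D.pathProd c t y m (fun _ => 1) ≠ 0 ∧ (∀ i ∈ S, ∃ k < m, c k = some i) ∧
      ∀ i, ∀ k < m, c k = some i → ∀ x : ℕ → A, x k ∈ D.P i → D.pathProd c t y m x = 0 := by
  classical
  obtain ⟨l, hl, hlS⟩ := hS
  let q : ℕ → Option (Fin D.r) × A := fun k => l.getD k (none, 0)
  have hq : l = (List.range l.length).map q := by
    refine List.ext_getElem (by simp) fun k h1 h2 => ?_
    simp [q, h1]
  let c : ℕ → Option (Fin D.r) := fun k => (q k).1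
  let y : ℕ → A := fun k => (q k).2
  have h0 : D.pathProd c (fun _ => 1) y l.length (fun _ => 1) ≠ 0 := by
    refine fun h => hl (Eq.trans ?_ h)
    conv_lhs => rw [hq, List.map_map]
    refine congrArg List.prod (List.map_congr_left fun k _ => ?_)
    simp only [Function.comp_apply, mul_one, c, y, E_mul_E]
  let T : Set ℕ := {n | ∃ (w : ℕ → ℕ) (t : ℕ → A), (∀ k, t k ∈ idealPow D.J (w k)) ∧
    D.pathProd c t y l.length (fun _ => 1) ≠ 0 ∧ ∑ k ∈ Finset.range l.length, w k = n}
  have hT : T.Nonempty := ⟨_, fun _ => 0, fun _ => 1, fun _ => trivial, h0, rfl⟩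
  have hTb : BddAbove T := by
    refine ⟨D.N, ?_⟩
    rintro _ ⟨w, t, ht, hne, rfl⟩
    by_contra hlt
    have h1 := idealPow_antitone D.isGradedIdeal_J (not_le.mp hlt).le
      (D.pathProd_mem_idealPow c t y l.length (fun _ => 1) w ht)
    rw [show idealPow D.J D.N = ⊥ from D.idealPow_eq_bot] at h1
    exact hne (by simpa using h1)
  obtain ⟨w, t, ht, hne, hw⟩ := Nat.sSup_mem hT hTb
  refine ⟨c, t, y, l.length, hne, ?_, ?_⟩
  · intro i hi
    obtain ⟨p, hp, hpi⟩ := hlS i hi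
    obtain ⟨k, hk, rfl⟩ := List.getElem_of_mem hp
    exact ⟨k, hk, by simpa [c, q, hk] using hpi⟩
  · intro i k hk hck x hx
    by_contra hne'
    have h1 : (∑ j ∈ Finset.range l.length, (w j + if j = k then 1 else 0)) ∈ T := by
      refine ⟨_, fun j => t j * (D.E (c j) * x j * D.E (c j)), fun j => ?_, ?_, rfl⟩
      · refine mul_mem_idealPow_add D.isGradedIdeal_J (ht j) ?_
        split_ifs with hj
        · subst hj
          rw [hck]
          exact mem_idealPow_one (D.e_mul_mul_e_mem_J_of_mem hx)
        · trivial
      · refine fun h => hne' (Eq.trans ?_ h)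
        refine congrArg List.prod (List.map_congr_left fun j _ => ?_)
        have hE := D.E_mul_E (c j)
        simp only [mul_assoc, mul_one]
        rw [← mul_assoc (D.E (c j)) (D.E (c j)) (y j), hE,
          ← mul_assoc (D.E (c j)) (D.E (c j)) (y j), hE]
    have h2 := le_csSup hTb h1
    rw [← hw, Finset.sum_add_distrib, Finset.sum_ite_eq', if_pos (Finset.mem_range.mpr hk)] at h2
    omega

/-- Products of functionals killing `D.PS S` times a fixed nonzero element are multilinear
functions with a bounded number of constants. -/
theorem Good.exists_prod_smul_mem [IsAlgClosed K] (hb : IsGradedBasis b deg)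
    {S : Finset (Fin D.r)} (hS : D.Good S) (q : ℕ) :
    ∃ w : A, w ≠ 0 ∧ ∃ k, ∀ (β : Fin q → A →ₗ[K] K) (_ : ∀ l, ∀ x ∈ D.PS S, β l x = 0)
      (j : Fin q → ℕ) (_ : Function.Injective j),
      (fun x => (∏ l, β l (x (j l))) • w) ∈ multi b deg (Finset.univ.image j) k := by
  classical
  obtain ⟨c, t, y, m, hne, hc, hzero⟩ := Good.exists_pathProd D hS
  obtain ⟨κ, hκ⟩ := exists_multi_opAlg (b := b) (deg := deg) hb
  choose! p hpm hpc using hc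
  refine ⟨_, hne, m * 2 + q * κ + m, fun β hβ j hj => ?_⟩
  obtain ⟨M, hM⟩ : ∃ M, ∀ l, j l < M :=
    ⟨Finset.univ.sup j + 1, fun l => Nat.lt_succ_of_le (Finset.le_sup (Finset.mem_univ l))⟩
  let ρ : ℕ → ℕ := fun k => M + k
  have hρ : Function.Injective ρ := fun a a' h => by simpa [ρ] using h
  let R := (Finset.range m).image ρ
  have hjR : ∀ l, j l ∉ R := by
    intro l hl
    obtain ⟨k, _, hk⟩ := Finset.mem_image.mp hl
    have := hM l
    simp only [ρ] at hk
    omega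
  let W : (ℕ → A) → A := fun x => D.pathProd c t y m fun k => x (ρ k)
  have hW : W ∈ multi b deg R (m * 2) := multi_rename (D.pathProd_mem_multi c t y m) hρ
  have step : ∀ (s : Finset ℕ) (k : ℕ) (f : (ℕ → A) → A), R ⊆ s → f ∈ multi b deg s k →
      (∀ i ∈ S, ∀ x, x (ρ (p i)) ∈ D.P i → f x = 0) → ∀ l, j l ∉ s →
      (fun x => β l (x (j l)) • f x) ∈ multi b deg (insert (j l) s) (k + κ) := by
    intro s k f hRs hf hfz l hl
    have h1 : ∀ i ∈ S, (fun x => β l (D.e i * x (j l)) • f x) ∈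
        multi b deg (insert (j l) s) (k + κ) := by
      intro i hi
      have hps : ρ (p i) ∈ s :=
        hRs (Finset.mem_image_of_mem ρ (Finset.mem_range.mpr (hpm i hi)))
      obtain ⟨φ, hφ, hφβ⟩ := (D.isMaximalGraded i).exists_opAlg
        (β l ∘ₗ LinearMap.mulLeft K (D.e i)) (by
          intro x hx
          refine hβ l _ (D.mem_PS.mpr fun i' _ => ?_)
          by_cases h : i = i'
          · exact h ▸ (D.isMaximalGraded i).isGradedIdeal.mul_mem_left _ hx
          · exact (D.isMaximalGraded i').isGradedIdeal.mul_mem_right _ (D.e_mem i i' h))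
      have hne' : j l ≠ ρ (p i) := fun h => hl (h ▸ hps)
      have h2 := multi_mul (hκ φ hφ (j l)) (multi_var (b := b) (deg := deg) (ρ (p i)))
        (by simpa using hne')
      have h3 := multi_subst hb hf h2 hps (by
        rw [Finset.disjoint_union_right]
        constructor
        · simp [hl]
        · simp)
      have h4 : s.erase (ρ (p i)) ∪ ({j l} ∪ {ρ (p i)}) = insert (j l) s := by
        ext a
        simp only [Finset.mem_union, Finset.mem_erase, Finset.mem_singleton, Finset.mem_insert]
        by_cases ha : a = ρ (p i)
        · simp [ha, hps]
        · simp [ha, or_comm]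
      rw [h4] at h3
      rw [add_zero] at h3
      convert h3 using 1
      ext x
      obtain ⟨L, hL⟩ := multi_update_linear hf hps x
      have h5 : L (φ (x (j l)) * x (ρ (p i)) - β l (D.e i * x (j l)) • x (ρ (p i))) = 0 := by
        rw [← hL]
        refine hfz i hi _ ?_
        rw [Function.update_self]
        have := (D.isMaximalGraded i).isGradedIdeal.mul_mem_right (x (ρ (p i))) (hφβ (x (j l)))
        rwa [sub_mul, smul_one_mul] at this
      rw [map_sub, sub_eq_zero, map_smul, ← hL, ← hL, Function.update_eq_self] at h5
      exact h5.symm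
    convert Submodule.sum_mem _ h1 using 1
    ext x
    rw [Finset.sum_apply, ← Finset.sum_smul, ← map_sum, ← Finset.sum_mul]
    congr 1
    rw [← sub_eq_zero, ← map_sub]
    refine hβ l _ (D.mem_PS.mpr fun i hi => ?_)
    have h6 : x (j l) - (∑ i ∈ S, D.e i) * x (j l) = (1 - ∑ i ∈ S, D.e i) * x (j l) := by
      rw [sub_mul, one_mul]
    rw [h6]
    refine (D.isMaximalGraded i).isGradedIdeal.mul_mem_right _ ?_
    rw [← Finset.add_sum_erase _ _ hi, ← sub_sub]
    exact (D.P i).sub_mem (D.one_sub_e_mem i)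
      ((D.P i).sum_mem fun i' hi' => D.e_mem _ _ (Finset.ne_of_mem_erase hi'))
  have iter : ∀ L : Finset (Fin q), (fun x => (∏ l ∈ L, β l (x (j l))) • W x) ∈
      multi b deg (L.image j ∪ R) (m * 2 + L.card * κ) := by
    intro L
    induction L using Finset.induction with
    | empty => simpa using hW
    | insert l L hl ih =>
      have := step _ _ _ Finset.subset_union_right ih (by
        intro i hi x hx
        rw [show W x = 0 from hzero i (p i) (hpm i hi) (hpc i hi) _ hx, smul_zero]) l (by
        rw [Finset.mem_union, not_or, hj.mem_finset_image]
        exact ⟨hl, hjR l⟩)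
      rw [Finset.card_insert_of_notMem hl, Finset.image_insert, Finset.insert_union, add_mul,
        one_mul, ← add_assoc]
      convert this using 1
      ext x
      rw [Finset.prod_insert hl, mul_smul]
  have h1 := multi_specialize_finset hb (iter Finset.univ) Finset.subset_union_right fun _ => 1
  have hd : Disjoint (Finset.univ.image j) R := by
    rw [Finset.disjoint_left]
    intro a ha
    obtain ⟨l, _, rfl⟩ := Finset.mem_image.mp ha
    exact hjR l
  rw [Finset.union_sdiff_cancel_right hd, Finset.card_image_of_injective _ hρ, Finset.card_range,
    Finset.card_univ, Fintype.card_fin] at h1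
  convert h1 using 1
  ext x
  congr 1
  · exact Finset.prod_congr rfl fun l _ => by
      beta_reduce
      rw [if_neg (hjR l)]
  · refine congrArg List.prod (List.map_congr_left fun k hk => ?_)
    beta_reduce
    rw [if_pos (Finset.mem_image_of_mem ρ (Finset.mem_range.mpr (List.mem_range.mp hk)))]

end Decomposition

end GradedCodim

namespace GradedCodim

set_option linter.unusedSectionVars false

/-- The trace of an endomorphism as the logarithmic derivative of the determinant. -/
theorem sum_det_update {K V ι : Type*} [Field K] [AddCommGroup V] [Module K V] [Fintype ι]
    [DecidableEq ι] (B : Module.Basis ι K V) (T : Module.End K V) (v : ι → V) :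
    ∑ k, B.det (Function.update v k (T (v k))) = LinearMap.trace K V T * B.det v := by
  have h1 : ∀ k, B.det (Function.update v k (T (v k))) =
      ((B.toMatrix v).adjugate * (LinearMap.toMatrix B B T * B.toMatrix v)) k k := by
    intro k
    rw [Module.Basis.det_apply, Module.Basis.toMatrix_update, ← Matrix.cramer_apply,
      Matrix.cramer_eq_adjugate_mulVec, Matrix.mul_apply, Matrix.mulVec, dotProduct]
    refine Finset.sum_congr rfl fun i _ => ?_
    congr 1
    rw [← LinearMap.toMatrix_mulVec_repr B B T (v k)]
    rfl
  simp_rw [h1]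
  rw [LinearMap.trace_eq_matrix_trace K B, Module.Basis.det_apply]
  change Matrix.trace _ = _
  rw [← Matrix.mul_assoc, Matrix.trace_mul_comm, ← Matrix.mul_assoc, Matrix.mul_adjugate,
    Matrix.smul_mul, Matrix.one_mul, Matrix.trace_smul, smul_eq_mul, mul_comm]

namespace Decomposition

variable {K A G I : Type*} [Field K] [Ring A] [Algebra K A] [Group G] [DecidableEq G]
  [Fintype I] {b : Module.Basis I K A} {deg : I → G} (D : Decomposition b deg)

theorem Good.exists_det_smul_mem [IsAlgClosed K] (hb : IsGradedBasis b deg)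
    {S : Finset (Fin D.r)} (hS : D.Good S) {d : ℕ} (B : Module.Basis (Fin d) K (A ⧸ D.PS S)) :
    ∃ w : A, w ≠ 0 ∧ ∃ k, ∀ (j : Fin d → ℕ) (_ : Function.Injective j),
      (fun x => B.det (fun l => (D.PS S).mkQ (x (j l))) • w) ∈
        multi b deg (Finset.univ.image j) k := by
  obtain ⟨w, hw, k, h⟩ := Good.exists_prod_smul_mem D hb hS d
  refine ⟨w, hw, k, fun j hj => ?_⟩
  have h1 : ∀ σ : Equiv.Perm (Fin d), (fun x : ℕ → A => (∏ l, (B.coord (σ l) ∘ₗ (D.PS S).mkQ)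
      (x (j l))) • w) ∈ multi b deg (Finset.univ.image j) k := by
    intro σ
    refine h (fun l => B.coord (σ l) ∘ₗ (D.PS S).mkQ) (fun l x hx => ?_) j hj
    rw [LinearMap.comp_apply, Submodule.mkQ_apply, (Submodule.Quotient.mk_eq_zero _).mpr hx,
      map_zero]
  have h2 := Submodule.sum_mem _ fun σ (_ : σ ∈ Finset.univ) =>
    Submodule.smul_mem _ ((Equiv.Perm.sign σ : ℤ) : K) (h1 σ)
  convert h2 using 1
  ext x
  rw [Finset.sum_apply, Module.Basis.det_apply, Matrix.det_apply', Finset.sum_smul]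
  refine Finset.sum_congr rfl fun σ _ => ?_
  rw [Pi.smul_apply, mul_smul]
  rfl

theorem prod_quotTrace_det_smul_mem (hb : IsGradedBasis b deg) {P : Submodule K A}
    (hP : IsGradedIdeal b deg P) {d : ℕ} (B : Module.Basis (Fin d) K (A ⧸ P)) {w : A} {k : ℕ}
    {j : Fin d → ℕ} (hj : Function.Injective j)
    (h : (fun x : ℕ → A => B.det (fun l => P.mkQ (x (j l))) • w) ∈
      multi b deg (Finset.univ.image j) k)
    {ι : Type*} {u v : ι → ℕ} (hu : Function.Injective u) (hv : Function.Injective v)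
    (huv : ∀ l l', u l ≠ v l') (huj : ∀ l i, j i ≠ u l) (hvj : ∀ l i, j i ≠ v l)
    (L : Finset ι) :
    (fun x : ℕ → A => (∏ l ∈ L, quotTrace hP (x (u l) * x (v l))) •
      B.det (fun l => P.mkQ (x (j l))) • w) ∈
      multi b deg (Finset.univ.image j ∪ (L.image u ∪ L.image v)) k := by
  classical
  induction L using Finset.induction with
  | empty => simpa using h
  | insert l L hl ih =>
    have h1 : ∀ i : Fin d, (fun x : ℕ → A => (∏ l ∈ L, quotTrace hP (x (u l) * x (v l))) •
        B.det (Function.update (fun l => P.mkQ (x (j l))) i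
          (quotLeft hP (x (u l) * x (v l)) (P.mkQ (x (j i))))) • w) ∈
        multi b deg (Finset.univ.image j ∪ ((insert l L).image u ∪ (insert l L).image v)) k := by
      intro i
      have h2 := multi_mul (multi_var (b := b) (deg := deg) (u l))
        (multi_mul (multi_var (b := b) (deg := deg) (v l)) (multi_var (b := b) (deg := deg) (j i))
        (by simpa using (hvj l i).symm)) (by simp [huv l l, (huj l i).symm])
      have h3 := multi_subst hb ih h2 (i := j i) (by simp) (by
        rw [Finset.disjoint_left]
        intro a ha ha'
        obtain ⟨ha1, ha2⟩ := Finset.mem_erase.mp ha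
        have hu' : u l ∉ L.image u := by rwa [hu.mem_finset_image]
        have hv' : v l ∉ L.image v := by rwa [hv.mem_finset_image]
        simp only [Finset.mem_union, Finset.mem_singleton, ha1, or_false] at ha' ha2
        rcases ha' with rfl | rfl
        · rcases ha2 with ha2 | ha2 | ha2
          · obtain ⟨i', _, hi'⟩ := Finset.mem_image.mp ha2
            exact huj l i' hi'
          · exact hu' ha2
          · obtain ⟨i', _, hi'⟩ := Finset.mem_image.mp ha2
            exact huv l i' hi'.symm
        · rcases ha2 with ha2 | ha2 | ha2
          · obtain ⟨i', _, hi'⟩ := Finset.mem_image.mp ha2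
            exact hvj l i' hi'
          · obtain ⟨i', _, hi'⟩ := Finset.mem_image.mp ha2
            exact huv i' l hi'
          · exact hv' ha2)
      have h4 : (Finset.univ.image j ∪ (L.image u ∪ L.image v)).erase (j i) ∪
          ({u l} ∪ ({v l} ∪ {j i})) =
          Finset.univ.image j ∪ ((insert l L).image u ∪ (insert l L).image v) := by
        rw [Finset.image_insert, Finset.image_insert]
        ext a
        have : a = j i → a ∈ Finset.univ.image j := fun h => h ▸ by simp
        simp only [Finset.mem_union, Finset.mem_erase, Finset.mem_singleton, Finset.mem_insert]
        tauto
      rw [h4] at h3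
      simp only [add_zero] at h3
      convert h3 using 1
      ext x
      congr 1
      · refine Finset.prod_congr rfl fun l' _ => ?_
        rw [Function.update_of_ne (huj l' i).symm, Function.update_of_ne (hvj l' i).symm]
      · congr 2
        ext l'
        by_cases hl' : l' = i
        · subst hl'
          rw [Function.update_self, Function.update_self, quotLeft_mkQ, mul_assoc]
        · rw [Function.update_of_ne hl', Function.update_of_ne (hj.ne hl')]
    convert Submodule.sum_mem _ fun i (_ : i ∈ Finset.univ) => h1 i using 1
    ext x
    rw [Finset.sum_apply, ← Finset.smul_sum, ← Finset.sum_smul, sum_det_update,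
      Finset.prod_insert hl, mul_comm, mul_smul, mul_smul]
    rfl

end Decomposition

end GradedCodim

namespace GradedCodim

set_option linter.unusedSectionVars false

section LowerBound

variable {K A G I : Type*} [Field K] [Ring A] [Algebra K A] [Group G] [DecidableEq G]
  [Fintype I] {b : Module.Basis I K A} {deg : I → G}

/-- Dual families for a nondegenerate trace form. -/
theorem exists_quotTrace_mul_eq {P : Submodule K A} (hP : IsGradedIdeal b deg P)
    (h : perp hP ⊤ ≤ P) {d : ℕ} (B : Module.Basis (Fin d) K (A ⧸ P)) :
    ∃ a a' : Fin d → A, ∀ i j, quotTrace hP (a i * a' j) = if i = j then 1 else 0 := by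
  choose a' ha' using fun j => P.mkQ_surjective (B j)
  let Ψ : A →ₗ[K] (Fin d → K) :=
    LinearMap.pi fun j => quotTrace hP ∘ₗ LinearMap.mulRight K (a' j)
  have hΨ : LinearMap.range Ψ = ⊤ := by
    by_contra hne
    obtain ⟨φ, hφ, hle⟩ := Submodule.exists_le_ker_of_lt_top _ (lt_top_iff_ne_top.mpr hne)
    let c : Fin d → K := fun j => φ fun i => if j = i then 1 else 0
    have hφc : ∀ v, φ v = ∑ j, v j * c j := fun v => LinearMap.pi_apply_eq_sum_univ φ v
    have h1 : ∑ j, c j • a' j ∈ perp hP ⊤ := by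
      intro v _
      have h2 : φ (Ψ v) = 0 := hle ⟨v, rfl⟩
      rw [hφc] at h2
      rw [quotTrace_mul_comm, Finset.mul_sum, map_sum, ← h2]
      refine Finset.sum_congr rfl fun j _ => ?_
      rw [mul_smul_comm, map_smul, smul_eq_mul, mul_comm]
      rfl
    have h3 : ∑ j, c j • B j = 0 := by
      rw [← (Submodule.Quotient.mk_eq_zero P).mpr (h h1), ← Submodule.mkQ_apply, map_sum]
      exact Finset.sum_congr rfl fun j _ => by rw [map_smul, ha']
    have h4 : ∀ j, c j = 0 := Fintype.linearIndependent_iff.mp B.linearIndependent c h3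
    exact hφ (LinearMap.ext fun v => by simp [hφc, h4])
  choose a ha using fun i : Fin d => LinearMap.range_eq_top.mp hΨ (Pi.single i 1)
  refine ⟨a, a', fun i j => ?_⟩
  have := congrFun (ha i) j
  rw [Pi.single_apply] at this
  simp_rw [eq_comm (a := i)]
  exact this

namespace Decomposition

variable (D : Decomposition b deg)

theorem Good.exists_prod_quotTrace_mem [IsAlgClosed K] (hb : IsGradedBasis b deg)
    {S : Finset (Fin D.r)} (hS : D.Good S) {d : ℕ} (B : Module.Basis (Fin d) K (A ⧸ D.PS S)) :
    ∃ w : A, w ≠ 0 ∧ ∃ k, ∀ (m : ℕ) (σ : Equiv.Perm (Fin m)),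
      (fun x => (∏ l : Fin m, quotTrace (D.isGradedIdeal_PS S) (x l * x (m + σ l))) • w) ∈
        multi b deg (Finset.range (2 * m)) k := by
  obtain ⟨w, hw, k, h⟩ := Good.exists_det_smul_mem D hb hS B
  choose y hy using fun j => (D.PS S).mkQ_surjective (B j)
  refine ⟨w, hw, k + d, fun m σ => ?_⟩
  let j : Fin d → ℕ := fun i => 2 * m + i
  have hj : Function.Injective j := fun i i' hi => by
    simp only [j] at hi
    exact Fin.ext (by omega)
  have h1 := prod_quotTrace_det_smul_mem hb (D.isGradedIdeal_PS S) B hj (h j hj)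
    (u := fun l : Fin m => (l : ℕ)) (v := fun l => m + σ l) Fin.val_injective
    (fun l l' hl => σ.injective (Fin.ext (by simpa using hl)))
    (fun l l' => by have := l.2; omega) (fun l i => by have := l.2; simp only [j]; omega)
    (fun l i => by have := (σ l).2; simp only [j]; omega) Finset.univ
  have h2 := multi_specialize_finset hb h1 Finset.subset_union_left fun n =>
    if h : n - 2 * m < d then y ⟨n - 2 * m, h⟩ else 0
  have hr : (Finset.univ.image (fun l : Fin m => (l : ℕ)) ∪
      Finset.univ.image fun l : Fin m => m + (σ l : ℕ)) = Finset.range (2 * m) := by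
    ext n
    simp only [Finset.mem_union, Finset.mem_image, Finset.mem_univ, true_and, Finset.mem_range]
    constructor
    · rintro (⟨l, rfl⟩ | ⟨l, rfl⟩)
      · have := l.2
        omega
      · have := (σ l).2
        omega
    · intro hn
      by_cases hnm : n < m
      · exact Or.inl ⟨⟨n, hnm⟩, rfl⟩
      · refine Or.inr ⟨σ.symm ⟨n - m, by omega⟩, ?_⟩
        rw [Equiv.apply_symm_apply]
        simp only
        omega
  have hjr : ∀ n ∈ Finset.range (2 * m), n ∉ Finset.univ.image j := by
    intro n hn hn'
    obtain ⟨i, _, rfl⟩ := Finset.mem_image.mp hn'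
    simp [j] at hn
  rw [hr, Finset.union_sdiff_cancel_left (Finset.disjoint_right.mpr hjr),
    Finset.card_image_of_injective _ hj, Finset.card_univ, Fintype.card_fin] at h2
  convert h2 using 1
  ext x
  congr 1
  · refine Finset.prod_congr rfl fun l _ => ?_
    beta_reduce
    rw [if_neg (hjr _ (Finset.mem_range.mpr (by have := l.2; omega))),
      if_neg (hjr _ (Finset.mem_range.mpr (by have := (σ l).2; omega)))]
  · have : (fun i => (D.PS S).mkQ (if j i ∈ Finset.univ.image j then
        if h : j i - 2 * m < d then y ⟨j i - 2 * m, h⟩ else 0 else x (j i))) = B := by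
      ext i
      rw [if_pos (Finset.mem_image_of_mem j (Finset.mem_univ i))]
      have hi : j i - 2 * m = i := by simp [j]
      simp only [hi, i.2, dif_pos, hy]
    rw [this, B.det_self, one_smul]

theorem Good.exists_pow_le_finrank_multi [IsAlgClosed K] [CharZero K] (hb : IsGradedBasis b deg)
    {S : Finset (Fin D.r)} (hS : D.Good S) : ∃ k, ∀ m,
      Module.finrank K (A ⧸ D.PS S) ^ (2 * m) ≤
        Module.finrank K (multi b deg (Finset.range (2 * m)) k) *
          (m + 1) ^ (Module.finrank K (A ⧸ D.PS S) ^ 2) := by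
  have : Module.Finite K A := Module.Finite.of_basis b
  let B := Module.finBasis K (A ⧸ D.PS S)
  obtain ⟨w, hw, k, h⟩ := Good.exists_prod_quotTrace_mem D hb hS B
  obtain ⟨a, a', ha⟩ := exists_quotTrace_mul_eq (D.isGradedIdeal_PS S) (D.perp_PS_le hb S) B
  obtain ⟨φ, hφ⟩ : ∃ φ : Module.Dual K A, φ w = 1 := by
    obtain ⟨φ, hφ⟩ := not_forall.mp fun h => hw ((Module.forall_dual_apply_eq_zero_iff K w).mp h)
    exact ⟨(φ w)⁻¹ • φ, inv_mul_cancel₀ hφ⟩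
  refine ⟨k, fun m => (pow_le_finrank_span_perm K _ m).trans (Nat.mul_le_mul_right _ ?_)⟩
  let X : (Fin m → Fin (Module.finrank K (A ⧸ D.PS S))) ×
      (Fin m → Fin (Module.finrank K (A ⧸ D.PS S))) → ℕ → A := fun p n =>
    if hn : n < m then a (p.1 ⟨n, hn⟩) else if hn : n - m < m then a' (p.2 ⟨n - m, hn⟩) else 0
  let Λ : ((ℕ → A) → A) →ₗ[K] ((Fin m → Fin (Module.finrank K (A ⧸ D.PS S))) ×
      (Fin m → Fin (Module.finrank K (A ⧸ D.PS S))) → K) :=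
    LinearMap.pi fun p => φ ∘ₗ LinearMap.proj (X p)
  refine (Submodule.finrank_mono ?_).trans
    (Submodule.finrank_map_le Λ (multi b deg (Finset.range (2 * m)) k))
  rw [Submodule.span_le]
  rintro _ ⟨σ, rfl⟩
  refine ⟨_, h m σ, funext fun p => ?_⟩
  change φ ((∏ l : Fin m, quotTrace (D.isGradedIdeal_PS S) (X p l * X p (m + σ l))) • w) = _
  have h1 : ∀ l : Fin m, quotTrace (D.isGradedIdeal_PS S) (X p l * X p (m + σ l)) =
      if p.1 l = p.2 (σ l) then 1 else 0 := by
    intro l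
    rw [← ha]
    simp [X]
  simp_rw [h1]
  rw [map_smul, hφ, smul_eq_mul, mul_one, Finset.prod_ite_zero]
  simp

theorem Good.exists_pow_le [IsAlgClosed K] [CharZero K] (hb : IsGradedBasis b deg)
    {S : Finset (Fin D.r)} (hS : D.Good S) : ∃ C E, ∀ᶠ n in Filter.atTop,
      Module.finrank K (A ⧸ D.PS S) ^ n ≤
        C * n ^ E * Module.finrank K (multi b deg (Finset.range n) 0) := by
  obtain ⟨κ, hκ⟩ := Good.exists_pow_le_finrank_multi D hb hS
  set d := Module.finrank K (A ⧸ D.PS S)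
  refine ⟨(d + 1) ^ (κ + 1) * (Fintype.card I + 1) ^ (κ + 1), d ^ 2,
    Filter.eventually_atTop.mpr ⟨κ + 2, fun n hn => ?_⟩⟩
  obtain ⟨m, k, hk, hk', rfl⟩ : ∃ m k, κ ≤ k ∧ k ≤ κ + 1 ∧ n = 2 * m + k :=
    ⟨(n - κ) / 2, κ + (n - κ) % 2, by omega, by omega, by omega⟩
  have h1 : d ^ k ≤ (d + 1) ^ (κ + 1) :=
    (Nat.pow_le_pow_left d.le_succ k).trans (Nat.pow_le_pow_right d.succ_pos hk')
  have h2 : Fintype.card I ^ k ≤ (Fintype.card I + 1) ^ (κ + 1) :=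
    (Nat.pow_le_pow_left (Nat.le_succ _) k).trans (Nat.pow_le_pow_right (Nat.succ_pos _) hk')
  have h3 : Module.finrank K (multi b deg (Finset.range (2 * m)) κ) ≤
      (Fintype.card I + 1) ^ (κ + 1) *
        Module.finrank K (multi b deg (Finset.range (2 * m + k)) 0) :=
    (Submodule.finrank_mono (multi_mono hk)).trans
      ((finrank_multi_range_le (2 * m) k).trans (Nat.mul_le_mul_right _ h2))
  have h4 : (m + 1) ^ d ^ 2 ≤ (2 * m + k) ^ d ^ 2 := Nat.pow_le_pow_left (by omega) _
  calc d ^ (2 * m + k) = d ^ k * d ^ (2 * m) := by rw [add_comm, pow_add]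
    _ ≤ (d + 1) ^ (κ + 1) * (((Fintype.card I + 1) ^ (κ + 1) *
        Module.finrank K (multi b deg (Finset.range (2 * m + k)) 0)) * (2 * m + k) ^ d ^ 2) :=
      Nat.mul_le_mul h1 ((hκ m).trans (Nat.mul_le_mul h3 h4))
    _ = _ := by ring

end Decomposition

end LowerBound

end GradedCodim

namespace GradedCodim

open Filter in
theorem exists_growth {K A G I : Type*} [Field K] [IsAlgClosed K] [CharZero K] [Ring A]
    [Algebra K A] [Group G] [DecidableEq G] [Fintype I] {b : Module.Basis I K A} {deg : I → G}
    (hb : IsGradedBasis b deg) : ∃ C E d : ℕ,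
      (∀ᶠ n in atTop, Module.finrank K (multi b deg (Finset.range n) 0) ≤ C * n ^ E * d ^ n) ∧
      ∀ᶠ n in atTop, d ^ n ≤ C * n ^ E * Module.finrank K (multi b deg (Finset.range n) 0) := by
  classical
  obtain ⟨D⟩ := nonempty_decomposition hb
  let T : Finset (Finset (Fin D.r)) := Finset.univ.filter D.Good
  let d := T.sup fun S => Module.finrank K (A ⧸ D.PS S)
  obtain ⟨C, E, h1⟩ := D.finrank_multi_upper hb (d := d) fun S hS =>
    Finset.le_sup (f := fun S => Module.finrank K (A ⧸ D.PS S)) (by simpa [T] using hS)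
  obtain ⟨C', E', h2⟩ : ∃ C E, ∀ᶠ n in atTop,
      d ^ n ≤ C * n ^ E * Module.finrank K (multi b deg (Finset.range n) 0) := by
    rcases T.eq_empty_or_nonempty with hT | hT
    · refine ⟨0, 0, eventually_atTop.mpr ⟨1, fun n hn => ?_⟩⟩
      simp only [d, hT, Finset.sup_empty, bot_eq_zero']
      rw [zero_pow (by omega)]
      exact Nat.zero_le _
    · obtain ⟨S, hS, hd⟩ := Finset.exists_mem_eq_sup T hT fun S => Module.finrank K (A ⧸ D.PS S)
      rw [show d = _ from hd]
      exact Decomposition.Good.exists_pow_le D hb (by simpa [T] using hS)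
  have h3 : ∀ n, 1 ≤ n → C * n ^ E ≤ max C C' * n ^ max E E' := fun n hn =>
    Nat.mul_le_mul (le_max_left _ _) (Nat.pow_le_pow_right hn (le_max_left _ _))
  have h4 : ∀ n, 1 ≤ n → C' * n ^ E' ≤ max C C' * n ^ max E E' := fun n hn =>
    Nat.mul_le_mul (le_max_right _ _) (Nat.pow_le_pow_right hn (le_max_right _ _))
  refine ⟨max C C', max E E', d, ?_, ?_⟩
  · filter_upwards [h1, eventually_ge_atTop 1] with n hn hn1
    exact hn.trans (Nat.mul_le_mul_right _ (h3 n hn1))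
  · filter_upwards [h2, eventually_ge_atTop 1] with n hn hn1
    exact hn.trans (Nat.mul_le_mul_right _ (h4 n hn1))

end GradedCodim

/-- the analog of Amitsur's conjecture for graded codimensions: for a
finite-dimensional associative algebra over a field of characteristic `0`, graded by an
arbitrary group, `lim_{n → ∞} (c_n^gr(A))^{1/n}` exists and is a nonnegative integer. -/
theorem stmt14 {F : Type*} [Field F] [CharZero F] {G : Type*} [Group G] [DecidableEq G]
    {A : Type*} [Ring A] [Algebra F A] [FiniteDimensional F A]
    (𝒜 : G → Submodule F A)
    (hmul : ∀ g h : G, ∀ a ∈ 𝒜 g, ∀ b ∈ 𝒜 h, a * b ∈ 𝒜 (g * h))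
    (hdecomp : DirectSum.IsInternal 𝒜) :
    ∃ d : ℕ, Filter.Tendsto
      (fun n : ℕ => (gradedCodim F 𝒜 n : ℝ) ^ (1 / (n : ℝ)))
      Filter.atTop (nhds (d : ℝ)) := by
  obtain ⟨N, b, deg, hb, hA⟩ := GradedCodim.exists_isGradedBasis 𝒜 hmul hdecomp
  have : CharZero (AlgebraicClosure F) := charZero_of_injective_algebraMap
    (algebraMap F (AlgebraicClosure F)).injective
  obtain ⟨C, E, d, h1, h2⟩ := GradedCodim.exists_growth
    (GradedCodim.IsGradedBasis.baseChange (AlgebraicClosure F) b deg hb)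
  refine ⟨d, tendsto_rpow_one_div_of_le (C := C) (D := E) ?_ ?_⟩
  · filter_upwards [h1] with n hn
    rwa [GradedCodim.gradedCodim_eq 𝒜 hA, ← GradedCodim.finrank_multi_baseChange
      (AlgebraicClosure F)]
  · filter_upwards [h2] with n hn
    rwa [GradedCodim.gradedCodim_eq 𝒜 hA, ← GradedCodim.finrank_multi_baseChange
      (AlgebraicClosure F)]
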